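/- arXiv:1902.00992 — 2 statements merged into one kernel-verified Lean document; each statement's English description precedes it below -/
import Mathlib

section
/- Let (Ω,Σ,P) be a probability space and let K be a convex set of random variables that is bounded in L^1(P). The following are equivalent: (1) there exists a probability measure Q equivalent to P such that K is Q-uniformly integrable; (2) for every ε > 0 there exists a measurable set A with P(A) > 1 − ε such that for every sequence (X_n) in K that is Cauchy in P-probability, E_P[|X_n − X_m|·1_A] → 0 as n,m → ∞; (3) for every measurable set A with P(A) > 0 there exists a measurable subset B of A with P(B) > 0 such that for every sequence (X_n) in K that is Cauchy in P-probability, E_P[|X_n − X_m|·1_B] → 0 as n,m → ∞; (4) for every measurable set A with P(A) > 0 there exists a measurable subset B of A with P(B) > 0 such that the set {X·1_B : X ∈ K} is P-uniformly integrable. -/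
open MeasureTheory Filter Set ProbabilityTheory

noncomputable section

namespace Paper

variable {Ω : Type*} [MeasurableSpace Ω]

/-- The metric `d(X,Y) = E_P[min(|X - Y|, 1)]` metrizing convergence in `P`-probability. -/
def probDist (P : Measure Ω) (X Y : Ω → ℝ) : ℝ :=
  ∫ ω, min |X ω - Y ω| 1 ∂P

/-- `Q` is a probability measure equivalent to `P` (mutually absolutely continuous). -/
def EquivProb (P Q : Measure Ω) : Prop :=
  IsProbabilityMeasure Q ∧ Q ≪ P ∧ P ≪ Q

/-- `K` is a set of `P`-integrable random variables bounded in `L¹(P)`. -/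
def BddL1 (P : Measure Ω) (K : Set (Ω → ℝ)) : Prop :=
  (∀ X ∈ K, Integrable X P) ∧ ∃ C : ℝ, ∀ X ∈ K, (∫ ω, |X ω| ∂P) ≤ C

/-- `K` is `Q`-uniformly integrable: all members are `Q`-integrable and
`sup_{X ∈ K} E_Q[|X| · 1_{|X| > c}] → 0` as `c → ∞`. -/
def UIset (Q : Measure Ω) (K : Set (Ω → ℝ)) : Prop :=
  (∀ X ∈ K, Integrable X Q) ∧
  ∀ ε : ℝ, 0 < ε → ∃ c : ℝ, ∀ X ∈ K, (∫ ω in {ω | c < |X ω|}, |X ω| ∂Q) < ε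

/-- The sequence `Xs` is Cauchy in `P`-probability. -/
def CauchyInProb (P : Measure Ω) (Xs : ℕ → Ω → ℝ) : Prop :=
  ∀ ε : ℝ, 0 < ε →
    Tendsto (fun p : ℕ × ℕ => P {ω | ε ≤ |Xs p.1 ω - Xs p.2 ω|}) atTop (nhds 0)

/-- The (sequential) closure of `K` in the topology of convergence in `P`-probability. -/
def probClosure (P : Measure Ω) (K : Set (Ω → ℝ)) : Set (Ω → ℝ) :=
  {X | ∃ Xs : ℕ → Ω → ℝ, (∀ n, Xs n ∈ K) ∧ TendstoInMeasure P Xs atTop X}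

/-- A set `W` of random variables is solid: if `X ∈ W` and `|Y| ≤ |X|` a.s. then `Y ∈ W`. -/
def SolidSet (P : Measure Ω) (W : Set (Ω → ℝ)) : Prop :=
  ∀ X ∈ W, ∀ Y : Ω → ℝ, AEStronglyMeasurable Y P →
    (∀ᵐ ω ∂P, |Y ω| ≤ |X ω|) → Y ∈ W

/-- The solid hull of a set `A` of random variables. -/
def solidHull (P : Measure Ω) (A : Set (Ω → ℝ)) : Set (Ω → ℝ) :=
  {Y | AEStronglyMeasurable Y P ∧ ∃ X ∈ A, ∀ᵐ ω ∂P, |Y ω| ≤ |X ω|}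

/-- The relative `L⁰(P)`-topology on `K` is uniformly locally convex-solid on `S`:
for every `ε > 0` there is a convex solid set `W` of integrable random variables contained in the
`ε`-ball around `0` such that, for each `X ∈ S`, `(X + W) ∩ K` contains a `d`-ball of `K`
around `X`. -/
def UnifLCS (P : Measure Ω) (K S : Set (Ω → ℝ)) : Prop :=
  ∀ ε : ℝ, 0 < ε → ∃ W : Set (Ω → ℝ),
    (∀ Z ∈ W, Integrable Z P) ∧ Convex ℝ W ∧ SolidSet P W ∧
    (∀ Z ∈ W, probDist P Z 0 < ε) ∧
    ∀ X ∈ S, ∃ δ : ℝ, 0 < δ ∧ ∀ Z ∈ K, probDist P Z X < δ → Z - X ∈ W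

/-- The `L⁰(Q)`- and `L¹(Q)`-topologies agree on `K`: a sequence in `K` converges in
`P`-probability to a member of `K` iff it converges in `L¹(Q)`-norm. -/
def TopAgree (P Q : Measure Ω) (K : Set (Ω → ℝ)) : Prop :=
  ∀ (Xs : ℕ → Ω → ℝ) (X : Ω → ℝ), (∀ n, Xs n ∈ K) → X ∈ K →
    (TendstoInMeasure P Xs atTop X ↔
      Tendsto (fun n => ∫⁻ ω, ENNReal.ofReal |Xs n ω - X ω| ∂Q) atTop (nhds 0))

/-- `W` is a forward convex combination of the sequence `Z`. -/
def IsFCC (Z : ℕ → Ω → ℝ) (W : ℕ → Ω → ℝ) : Prop :=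
  ∀ k, W k ∈ convexHull ℝ (Z '' {n | k ≤ n})

/-- The relative `L⁰(P)`-topology on `K` is locally convex at `X` (forward convex combination
formulation): every FCC of a sequence in `K` converging to `X` in probability also converges
to `X` in probability. -/
def LocConvexAt (P : Measure Ω) (K : Set (Ω → ℝ)) (X : Ω → ℝ) : Prop :=
  ∀ Xs : ℕ → Ω → ℝ, (∀ n, Xs n ∈ K) → TendstoInMeasure P Xs atTop X →
    ∀ W : ℕ → Ω → ℝ, IsFCC Xs W → TendstoInMeasure P W atTop X

/-- The set `L = {Σ_k a_k R_k : Σ_k |a_k| ≤ 1}` (with pointwise a.e. absolutely convergent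
series, which also converge in `L¹(P)`). -/
def Lset (R : ℕ → Ω → ℝ) : Set (Ω → ℝ) :=
  {G | ∃ a : ℕ → ℝ, Summable (fun k => |a k|) ∧ (∑' k, |a k|) ≤ 1 ∧
    G = fun ω => ∑' k, a k * R k ω}

/-- The standard Cauchy distribution on `ℝ`. -/
def cauchyLaw : Measure ℝ :=
  MeasureTheory.volume.withDensity (fun t => ENNReal.ofReal (1 / (Real.pi * (1 + t ^ 2))))

/-- Local convexity of the relative topology on `A ⊆ E` at a point `x ∈ A`, in a topological
vector space. -/
def LocConvexAtTVS {E : Type*} [AddCommGroup E] [Module ℝ E] [TopologicalSpace E]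
    (A : Set E) (x : E) : Prop :=
  ∀ V ∈ nhds (0 : E), ∃ U ∈ nhds (0 : E), ∃ C : Set E,
    Convex ℝ C ∧ ((fun u => x + u) '' U) ∩ A ⊆ C ∧ C ⊆ ((fun v => x + v) '' V) ∩ A

/-- The `K`-uniform tails of a set of functions are small with respect to `μ`. -/
def TailSmall (μ : Measure Ω) (K : Set (Ω → ℝ)) : Prop :=
  ∀ ε : ENNReal, 0 < ε → ∃ c : ℝ, ∀ X ∈ K, (∫⁻ ω in {ω | c < |X ω|}, ‖X ω‖ₑ ∂μ) ≤ ε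

lemma uiset_iff_tailSmall (μ : Measure Ω) (K : Set (Ω → ℝ)) (hK : ∀ X ∈ K, Integrable X μ) :
    UIset μ K ↔ TailSmall μ K := by
  have key : ∀ X ∈ K, ∀ c : ℝ, ENNReal.ofReal (∫ ω in {ω | c < |X ω|}, |X ω| ∂μ)
      = ∫⁻ ω in {ω | c < |X ω|}, ‖X ω‖ₑ ∂μ := fun X hX c =>
    ofReal_integral_norm_eq_lintegral_enorm (hK X hX).integrableOn
  constructor
  · rintro ⟨-, h⟩ ε hε
    rcases eq_or_ne ε ⊤ with rfl | hε'
    · exact ⟨0, fun X _ => le_top⟩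
    obtain ⟨c, hc⟩ := h ε.toReal (ENNReal.toReal_pos hε.ne' hε')
    refine ⟨c, fun X hX => ?_⟩
    rw [← key X hX, ← ENNReal.ofReal_toReal hε']
    exact ENNReal.ofReal_le_ofReal (hc X hX).le
  · refine fun h => ⟨hK, fun ε hε => ?_⟩
    obtain ⟨c, hc⟩ := h (ENNReal.ofReal (ε / 2)) (ENNReal.ofReal_pos.2 (half_pos hε))
    refine ⟨c, fun X hX => ?_⟩
    have := hc X hX
    rw [← key X hX, ENNReal.ofReal_le_ofReal_iff (half_pos hε).le] at this
    linarith

lemma uiset_indicator_iff (P : Measure Ω) (K : Set (Ω → ℝ)) {B : Set Ω} (hB : MeasurableSet B) :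
    UIset P ((fun X => B.indicator X) '' K) ↔ UIset (P.restrict B) K := by
  have key : ∀ (X : Ω → ℝ) (c : ℝ), ∫ ω in {ω | c < |B.indicator X ω|}, |B.indicator X ω| ∂P
      = ∫ ω in {ω | c < |X ω|}, |X ω| ∂(P.restrict B) := by
    intro X c
    have h1 : (fun ω => |B.indicator X ω|) = B.indicator (fun ω => |X ω|) := by
      ext ω; by_cases h : ω ∈ B <;> simp [h]
    rw [h1, setIntegral_indicator hB, Measure.restrict_restrict' hB]
    congr 2
    ext ω
    by_cases h : ω ∈ B <;> simp [h]
  simp only [UIset, forall_mem_image, key, integrable_indicator_iff hB, IntegrableOn]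

lemma TailSmall.antitone_measure {μ ν : Measure Ω} {K : Set (Ω → ℝ)} (h : TailSmall μ K)
    (hν : ν ≤ μ) : TailSmall ν K := by
  intro ε hε
  obtain ⟨c, hc⟩ := h ε hε
  exact ⟨c, fun X hX => (lintegral_mono' (Measure.restrict_mono le_rfl hν) le_rfl).trans (hc X hX)⟩

lemma setLIntegral_tail_anti (μ : Measure Ω) (X : Ω → ℝ) {c d : ℝ} (h : c ≤ d) :
    (∫⁻ ω in {ω | d < |X ω|}, ‖X ω‖ₑ ∂μ) ≤ ∫⁻ ω in {ω | c < |X ω|}, ‖X ω‖ₑ ∂μ :=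
  lintegral_mono_set fun _ hω => lt_of_le_of_lt h hω

lemma TailSmall.add {μ ν : Measure Ω} {K : Set (Ω → ℝ)} (hμ : TailSmall μ K)
    (hν : TailSmall ν K) : TailSmall (μ + ν) K := by
  intro ε hε
  obtain ⟨c, hc⟩ := hμ (ε / 2) (ENNReal.half_pos hε.ne')
  obtain ⟨d, hd⟩ := hν (ε / 2) (ENNReal.half_pos hε.ne')
  refine ⟨max c d, fun X hX => ?_⟩
  rw [Measure.restrict_add, lintegral_add_measure, ← ENNReal.add_halves ε]
  exact add_le_add ((setLIntegral_tail_anti μ X (le_max_left c d)).trans (hc X hX))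
    ((setLIntegral_tail_anti ν X (le_max_right c d)).trans (hd X hX))

lemma TailSmall.smul {μ : Measure Ω} {K : Set (Ω → ℝ)} (hμ : TailSmall μ K) {a : ENNReal}
    (ha : a ≠ ⊤) : TailSmall (a • μ) K := by
  intro ε hε
  obtain ⟨c, hc⟩ := hμ (ε / a) (ENNReal.div_pos hε.ne' ha)
  refine ⟨c, fun X hX => ?_⟩
  rw [Measure.restrict_smul, lintegral_smul_measure, smul_eq_mul]
  exact (mul_le_mul_right (hc X hX) a).trans ENNReal.mul_div_le

lemma tailSmall_finset_sum (μ : ℕ → Measure Ω) {K : Set (Ω → ℝ)} (hμ : ∀ n, TailSmall (μ n) K)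
    (N : ℕ) : TailSmall (∑ n ∈ Finset.range N, μ n) K := by
  induction N with
  | zero => exact fun ε _ => ⟨0, fun X _ => by simp⟩
  | succ N ih => rw [Finset.sum_range_succ]; exact ih.add (hμ N)

lemma tailSmall_sum {μ : ℕ → Measure Ω} {K : Set (Ω → ℝ)} (hμ : ∀ n, TailSmall (μ n) K)
    {b : ℕ → ENNReal} (hb : ∑' n, b n ≠ ⊤) (hKb : ∀ X ∈ K, ∀ n, ∫⁻ ω, ‖X ω‖ₑ ∂(μ n) ≤ b n) :
    TailSmall (Measure.sum μ) K := by
  intro ε hε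
  obtain ⟨N, hN⟩ := ((ENNReal.tendsto_sum_nat_add b hb).eventually_lt_const
    (ENNReal.half_pos hε.ne')).exists
  obtain ⟨c, hc⟩ := tailSmall_finset_sum μ hμ N (ε / 2) (ENNReal.half_pos hε.ne')
  refine ⟨c, fun X hX => ?_⟩
  have hc' := hc X hX
  rw [← Measure.restrictₗ_apply, map_sum, lintegral_finsetSum_measure] at hc'
  simp only [Measure.restrictₗ_apply] at hc'
  rw [Measure.restrict_sum_of_countable, lintegral_sum_measure,
    ← Summable.sum_add_tsum_nat_add' (k := N) ENNReal.summable, ← ENNReal.add_halves ε]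
  refine add_le_add hc' (le_trans (ENNReal.tsum_le_tsum fun n => ?_) hN.le)
  exact (setLIntegral_le_lintegral _ _).trans (hKb X hX (n + N))

lemma tendsto_lintegral_of_cauchyInProb {P μ : Measure Ω} [IsFiniteMeasure P] (hμ : μ ≤ P)
    {K : Set (Ω → ℝ)} (hK : ∀ X ∈ K, Integrable X P) (hT : TailSmall μ K)
    {Xs : ℕ → Ω → ℝ} (hXs : ∀ n, Xs n ∈ K) (hC : CauchyInProb P Xs) :
    Tendsto (fun p : ℕ × ℕ => ∫⁻ ω, ENNReal.ofReal |Xs p.1 ω - Xs p.2 ω| ∂μ) atTop (nhds 0) := by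
  have : IsFiniteMeasure μ := isFiniteMeasure_of_le P hμ
  rw [ENNReal.tendsto_nhds_zero]
  intro ε hε
  rcases eq_or_ne ε ⊤ with rfl | hε'
  · simp
  have hε4 : 0 < ε / 4 := ENNReal.div_pos hε.ne' (by simp)
  obtain ⟨c, hc⟩ := hT (ε / 4) hε4
  obtain ⟨δ, hδ, hδε⟩ : ∃ δ : ℝ, 0 < δ ∧ ENNReal.ofReal δ * P univ ≤ ε / 4 := by
    obtain ⟨δ, hδ, h⟩ := ENNReal.exists_nnreal_pos_mul_lt (measure_ne_top P univ) hε4.ne'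
    exact ⟨δ, hδ, by simpa using h.le⟩
  set M : ℝ := 2 * |c|
  have hM : 0 ≤ M := by positivity
  have h0 := ENNReal.Tendsto.const_mul (a := ENNReal.ofReal M) (hC δ hδ)
    (Or.inr ENNReal.ofReal_ne_top)
  rw [mul_zero, ENNReal.tendsto_nhds_zero] at h0
  filter_upwards [h0 (ε / 4) hε4] with p hp
  set x := Xs p.1
  set y := Xs p.2
  have hx : AEMeasurable x μ := ((hK _ (hXs p.1)).mono_measure hμ).aemeasurable
  have hy : AEMeasurable y μ := ((hK _ (hXs p.2)).mono_measure hμ).aemeasurable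
  have hpt : ∀ ω, ENNReal.ofReal |x ω - y ω| ≤ ENNReal.ofReal δ +
      ({ω | δ ≤ |x ω - y ω|}.indicator (fun _ => ENNReal.ofReal M) ω +
      ({ω | |c| < |x ω|}.indicator (fun ω => ‖x ω‖ₑ) ω +
      {ω | |c| < |y ω|}.indicator (fun ω => ‖y ω‖ₑ) ω)) := by
    intro ω
    rcases lt_or_ge |x ω - y ω| δ with h | h
    · exact (ENNReal.ofReal_le_ofReal h.le).trans le_self_add
    · refine le_trans ?_ le_add_self
      have hz : ∀ z : Ω → ℝ, {ω | |c| < |z ω|}.indicator (fun ω => ‖z ω‖ₑ) ω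
          = ENNReal.ofReal (if |c| < |z ω| then |z ω| else 0) := by
        intro z
        by_cases hzc : |c| < |z ω| <;> simp [hzc, Real.enorm_eq_ofReal_abs]
      rw [hz x, hz y, indicator_of_mem (by exact h), ← ENNReal.ofReal_add (by positivity)
        (by positivity), ← ENNReal.ofReal_add hM (by positivity)]
      refine ENNReal.ofReal_le_ofReal ?_
      have h1 : ∀ z : ℝ, |z| ≤ |c| + if |c| < |z| then |z| else 0 := by
        intro z; split_ifs <;> [linarith [abs_nonneg c]; linarith]
      linarith [h1 (x ω), h1 (y ω), abs_sub (x ω) (y ω)]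
  have hS : ∀ z : Ω → ℝ, AEMeasurable z μ → NullMeasurableSet {ω | |c| < |z ω|} μ := fun z hz =>
    nullMeasurableSet_lt aemeasurable_const (continuous_abs.measurable.comp_aemeasurable hz)
  have hD : NullMeasurableSet {ω | δ ≤ |x ω - y ω|} μ :=
    nullMeasurableSet_le aemeasurable_const
      (continuous_abs.measurable.comp_aemeasurable (hx.sub hy))
  calc _ ≤ _ := lintegral_mono hpt
    _ = ENNReal.ofReal δ * μ univ + (∫⁻ ω, {ω | δ ≤ |x ω - y ω|}.indicator
          (fun _ => ENNReal.ofReal M) ω ∂μ + (∫⁻ ω, {ω | |c| < |x ω|}.indicator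
          (fun ω => ‖x ω‖ₑ) ω ∂μ + ∫⁻ ω, {ω | |c| < |y ω|}.indicator (fun ω => ‖y ω‖ₑ) ω ∂μ)) := by
        rw [lintegral_add_left measurable_const, lintegral_const,
          lintegral_add_left' (aemeasurable_const.indicator₀ hD),
          lintegral_add_left' (hx.enorm.indicator₀ (hS x hx))]
    _ ≤ ε / 4 + (ε / 4 + (ε / 4 + ε / 4)) := by
        refine add_le_add ((mul_le_mul_right (hμ univ) _).trans hδε) (add_le_add ?_
          (add_le_add ?_ ?_))
        · exact (lintegral_indicator_const_le _ _).trans ((mul_le_mul_right (hμ _) _).trans hp)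
        · exact (lintegral_indicator_le _ _).trans
            ((setLIntegral_tail_anti μ x (le_abs_self c)).trans (hc x (hXs p.1)))
        · exact (lintegral_indicator_le _ _).trans
            ((setLIntegral_tail_anti μ y (le_abs_self c)).trans (hc y (hXs p.2)))
    _ = ε := by
        rw [← ENNReal.toReal_eq_toReal_iff' (by finiteness) hε']
        rw [ENNReal.toReal_add (by finiteness) (by finiteness),
          ENNReal.toReal_add (by finiteness) (by finiteness),
          ENNReal.toReal_add (by finiteness) (by finiteness), ENNReal.toReal_div]
        norm_num
        ring

lemma exists_restrict_le_smul {P Q : Measure Ω} [IsProbabilityMeasure P] [IsProbabilityMeasure Q]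
    (hPQ : P ≪ Q) {ε : ℝ} (hε : 0 < ε) :
    ∃ A : Set Ω, MeasurableSet A ∧ 1 - ε < (P A).toReal ∧
      ∃ k : ℕ, P.restrict A ≤ (k : ENNReal) • Q := by
  set f := P.rnDeriv Q
  have hf : Measurable f := Measure.measurable_rnDeriv P Q
  set A : ℕ → Set Ω := fun k => {ω | f ω ≤ k}
  have hAm : ∀ k, MeasurableSet (A k) := fun k => measurableSet_le hf measurable_const
  have hAmono : Monotone A := fun i j hij ω hω => 
    le_trans (show f ω ≤ i from hω) (Nat.cast_le.2 hij)
  have hlim := tendsto_measure_iUnion_atTop (μ := P) hAmono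
  have hU : P (⋃ k, A k) = 1 := by
    rw [prob_compl_eq_zero_iff (MeasurableSet.iUnion hAm) |>.symm, ← nonpos_iff_eq_zero]
    refine le_of_le_of_eq (measure_mono ?_) (hPQ.ae_le (Measure.rnDeriv_lt_top P Q))
    intro ω hω hlt
    obtain ⟨k, hk⟩ := ENNReal.exists_nat_gt (ne_of_lt hlt)
    exact hω (mem_iUnion.2 ⟨k, hk.le⟩)
  rw [hU] at hlim
  have hlim' := (ENNReal.tendsto_toReal ENNReal.one_ne_top).comp hlim
  obtain ⟨k, hk⟩ := (hlim'.eventually_const_lt (u := 1 - ε) (by simpa using hε)).exists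
  refine ⟨A k, hAm k, hk, k, Measure.le_iff.2 fun S hS => ?_⟩
  rw [Measure.restrict_apply hS]
  conv_lhs => rw [← Measure.withDensity_rnDeriv_eq P Q hPQ]
  rw [withDensity_apply _ (hS.inter (hAm k)), Measure.smul_apply, smul_eq_mul]
  calc ∫⁻ ω in S ∩ A k, f ω ∂Q ≤ ∫⁻ _ in S ∩ A k, k ∂Q :=
        setLIntegral_mono' (hS.inter (hAm k)) fun ω hω => hω.2
    _ = k * Q (S ∩ A k) := by rw [setLIntegral_const]
    _ ≤ k * Q S := mul_le_mul_right (measure_mono inter_subset_left) _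

lemma sqrt_one_add_sq_midpoint_gap (x y : ℝ) :
    (x - y) ^ 2 ≤ 2 * (√(1 + x ^ 2) * √(1 + y ^ 2) * (√(1 + x ^ 2) + √(1 + y ^ 2))) *
      (√(1 + x ^ 2) + √(1 + y ^ 2) - 2 * √(1 + ((x + y) / 2) ^ 2)) := by
  have hx : √(1 + x ^ 2) ^ 2 = 1 + x ^ 2 := Real.sq_sqrt (by positivity)
  have hy : √(1 + y ^ 2) ^ 2 = 1 + y ^ 2 := Real.sq_sqrt (by positivity)
  have hm : √(1 + ((x + y) / 2) ^ 2) ^ 2 = 1 + ((x + y) / 2) ^ 2 := Real.sq_sqrt (by positivity)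
  have hx0 : 0 < √(1 + x ^ 2) := by positivity
  have hy0 : 0 < √(1 + y ^ 2) := by positivity
  have hm0 : 0 < √(1 + ((x + y) / 2) ^ 2) := by positivity
  set a := √(1 + x ^ 2)
  set b := √(1 + y ^ 2)
  set m := √(1 + ((x + y) / 2) ^ 2)
  have hab : (a * b) ^ 2 = (1 + x * y) ^ 2 + (x - y) ^ 2 := by rw [mul_pow, hx, hy]; ring
  have h1 : 1 + x * y ≤ a * b := by
    refine le_of_sq_le_sq ?_ (by positivity)
    nlinarith [sq_nonneg (x - y)]
  have h2 : (a + b) ^ 2 - (2 * m) ^ 2 = 2 * (a * b - (1 + x * y)) := by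
    rw [mul_pow, hm, add_sq, hx, hy]; ring
  have h3 : 2 * m ≤ a + b := le_of_sq_le_sq (by linarith) (by positivity)
  have h4 : (x - y) ^ 2 ≤ (a * b - (1 + x * y)) * (2 * (a * b)) := by nlinarith
  have h5 : 2 * (a * b - (1 + x * y)) ≤ (a + b - 2 * m) * (2 * (a + b)) := by nlinarith
  nlinarith [mul_le_mul_of_nonneg_right h5 (show 0 ≤ a * b by positivity)]

lemma exists_cauchyInProb_of_antitone_convex {P : Measure Ω} [IsProbabilityMeasure P]
    {K : Set (Ω → ℝ)} (hK : BddL1 P K) {C : ℕ → Set (Ω → ℝ)} (hCK : ∀ n, C n ⊆ K)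
    (hCconv : ∀ n, Convex ℝ (C n)) (hCanti : Antitone C) (hCne : ∀ n, (C n).Nonempty) :
    ∃ W : ℕ → Ω → ℝ, (∀ n, W n ∈ C n) ∧ CauchyInProb P W := by
  obtain ⟨hint, c, hc⟩ := hK
  set Φ : (Ω → ℝ) → ℝ := fun X => ∫ ω, √(1 + X ω ^ 2) ∂P
  have hle : ∀ t : ℝ, √(1 + t ^ 2) ≤ 1 + |t| := fun t => by
    rw [Real.sqrt_le_left (by positivity)]; nlinarith [abs_nonneg t, sq_abs t]
  have hφ : ∀ X ∈ K, Integrable (fun ω => √(1 + X ω ^ 2)) P := by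
    intro X hX
    refine Integrable.mono' ((integrable_const 1).add (hint X hX).abs) ?_ ?_
    · exact (by fun_prop : Continuous fun t : ℝ => √(1 + t ^ 2)).comp_aestronglyMeasurable
        (hint X hX).1
    · exact Eventually.of_forall fun ω => by
        rw [Real.norm_of_nonneg (by positivity)]; exact hle _
  have hΦ0 : ∀ X, 0 ≤ Φ X := fun X => integral_nonneg fun ω => by positivity
  have hΦC : ∀ X ∈ K, Φ X ≤ 1 + c := by
    intro X hX
    calc Φ X ≤ ∫ ω, (1 + |X ω|) ∂P := integral_mono (hφ X hX)
          ((integrable_const 1).add (hint X hX).abs) fun ω => hle _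
      _ = 1 + ∫ ω, |X ω| ∂P := by rw [integral_add (integrable_const 1) (hint X hX).abs]; simp
      _ ≤ 1 + c := by linarith [hc X hX]
  set d : ℕ → ℝ := fun n => sInf (Φ '' C n)
  have hbdd : ∀ n, BddBelow (Φ '' C n) := fun n => ⟨0, by rintro _ ⟨X, -, rfl⟩; exact hΦ0 X⟩
  have hd : ∀ n, ∀ X ∈ C n, d n ≤ Φ X := fun n X hX => csInf_le (hbdd n) (mem_image_of_mem _ hX)
  have hdmono : Monotone d := fun i j hij =>
    csInf_le_csInf (hbdd i) ((hCne j).image _) (image_mono (hCanti hij))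
  have hdbdd : BddAbove (range d) := by
    refine ⟨1 + c, ?_⟩
    rintro _ ⟨n, rfl⟩
    obtain ⟨X, hX⟩ := hCne n
    exact (hd n X hX).trans (hΦC X (hCK n hX))
  have hpick : ∀ n : ℕ, ∃ X ∈ C n, Φ X < d n + 1 / ((n : ℝ) + 1) := by
    intro n
    obtain ⟨_, ⟨X, hX, rfl⟩, h⟩ := exists_lt_of_csInf_lt ((hCne n).image Φ)
      (show sInf (Φ '' C n) < d n + 1 / ((n : ℝ) + 1) from lt_add_of_pos_right _ (by positivity))
    exact ⟨X, hX, h⟩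
  choose W hWC hW using hpick
  refine ⟨W, hWC, ?_⟩
  have hWK : ∀ n, W n ∈ K := fun n => hCK n (hWC n)
  set G : ℕ → ℕ → Ω → ℝ := fun n m ω =>
    √(1 + W n ω ^ 2) + √(1 + W m ω ^ 2) - 2 * √(1 + ((W n ω + W m ω) / 2) ^ 2)
  have hmid : ∀ n m, n ≤ m → (fun ω => (W n ω + W m ω) / 2) ∈ C n := by
    intro n m hnm
    convert hCconv n (hWC n) (hCanti hnm (hWC m)) (by norm_num : (0 : ℝ) ≤ 1 / 2)
      (by norm_num : (0 : ℝ) ≤ 1 / 2) (by norm_num) using 1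
    ext ω; simp; ring
  have hGint : ∀ n m, n ≤ m → Integrable (G n m) P := fun n m hnm =>
    ((hφ _ (hWK n)).add (hφ _ (hWK m))).sub ((hφ _ (hCK n (hmid n m hnm))).const_mul 2)
  set e : ℕ → ℝ := fun n => (⨆ i, d i) - d n + 2 * (1 / ((n : ℝ) + 1))
  have he : Tendsto e atTop (nhds 0) := by
    have := (tendsto_const_nhds (x := ⨆ i, d i)).sub (tendsto_atTop_ciSup hdmono hdbdd) |>.add
      (tendsto_one_div_add_atTop_nhds_zero_nat.const_mul 2)
    simpa [e] using this
  have hGe : ∀ n m, n ≤ m → ∫ ω, G n m ω ∂P ≤ e n := by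
    intro n m hnm
    have h1 : ∫ ω, G n m ω ∂P = Φ (W n) + Φ (W m) - 2 * Φ (fun ω => (W n ω + W m ω) / 2) := by
      have hs : Integrable (fun ω => √(1 + W n ω ^ 2) + √(1 + W m ω ^ 2)) P :=
        (hφ _ (hWK n)).add (hφ _ (hWK m))
      simp only [G, Φ]
      rw [integral_sub hs
        ((hφ _ (hCK n (hmid n m hnm))).const_mul 2), integral_add (hφ _ (hWK n)) (hφ _ (hWK m)),
        integral_const_mul]
    have h2 := hd n _ (hmid n m hnm)
    have h3 : d m ≤ ⨆ i, d i := le_ciSup hdbdd m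
    have h4 : 1 / ((m : ℝ) + 1) ≤ 1 / ((n : ℝ) + 1) := by gcongr
    rw [h1]
    linarith [hW n, hW m]
  have hG0 : ∀ n m ω, 0 ≤ G n m ω := by
    intro n m ω
    have h := (sq_nonneg _).trans (sqrt_one_add_sq_midpoint_gap (W n ω) (W m ω))
    exact nonneg_of_mul_nonneg_right h (by positivity)
  have hc0 : 0 ≤ c := (integral_nonneg fun ω => abs_nonneg _).trans (hc _ (hWK 0))
  have hreal : ∀ ε : ℝ, 0 < ε → ∀ δ : ℝ, 0 < δ → ∃ N, ∀ n m, N ≤ n → n ≤ m →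
      P.real {ω | ε ≤ |W n ω - W m ω|} ≤ δ := by
    intro ε hε δ hδ
    obtain ⟨M, hM, hMδ⟩ : ∃ M : ℝ, 0 < M ∧ c / M ≤ δ / 3 := by
      refine ⟨3 * (c + 1) / δ, by positivity, ?_⟩
      rw [div_le_div_iff₀ (by positivity) (by positivity)]
      field_simp
      linarith
    set κ : ℝ := ε ^ 2 / (4 * (1 + M) ^ 3)
    have hκ : 0 < κ := by positivity
    obtain ⟨N, hN⟩ := eventually_atTop.1
      (he.eventually_lt_const (show 0 < κ * (δ / 3) by positivity))
    refine ⟨N, fun n m hn hnm => ?_⟩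
    have hsub : {ω | ε ≤ |W n ω - W m ω|} ⊆
        {ω | M ≤ |W n ω|} ∪ {ω | M ≤ |W m ω|} ∪ {ω | κ ≤ G n m ω} := by
      intro ω hω
      by_contra hcon
      simp only [mem_union, mem_ofPred_eq, not_or, not_le] at hcon hω
      obtain ⟨⟨h1, h2⟩, h3⟩ := hcon
      have hgap := sqrt_one_add_sq_midpoint_gap (W n ω) (W m ω)
      change _ ≤ _ * G n m ω at hgap
      have ha : √(1 + W n ω ^ 2) ≤ 1 + M := (hle _).trans (by linarith)
      have hb : √(1 + W m ω ^ 2) ≤ 1 + M := (hle _).trans (by linarith)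
      have hprod : 2 * (√(1 + W n ω ^ 2) * √(1 + W m ω ^ 2) *
          (√(1 + W n ω ^ 2) + √(1 + W m ω ^ 2))) ≤ 4 * (1 + M) ^ 3 := by
        calc _ ≤ 2 * ((1 + M) * (1 + M) * ((1 + M) + (1 + M))) := by gcongr
          _ = 4 * (1 + M) ^ 3 := by ring
      have h4 : ε ^ 2 ≤ (W n ω - W m ω) ^ 2 := by
        rw [← sq_abs (W n ω - W m ω)]; gcongr
      have h5 : ε ^ 2 ≤ 4 * (1 + M) ^ 3 * G n m ω :=
        h4.trans (hgap.trans (mul_le_mul_of_nonneg_right hprod (hG0 n m ω)))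
      refine absurd h3 (not_lt.2 ?_)
      rw [div_le_iff₀ (by positivity)]
      linarith
    have hmark : ∀ i, P.real {ω | M ≤ |W i ω|} ≤ δ / 3 := by
      intro i
      refine le_trans ?_ hMδ
      rw [le_div_iff₀ hM, mul_comm]
      exact (mul_meas_ge_le_integral_of_nonneg (Eventually.of_forall fun ω => abs_nonneg _)
        (hint _ (hWK i)).abs M).trans (hc _ (hWK i))
    have hmarkG : P.real {ω | κ ≤ G n m ω} ≤ δ / 3 := by
      refine le_of_mul_le_mul_left ?_ hκ
      exact (mul_meas_ge_le_integral_of_nonneg (Eventually.of_forall (hG0 n m))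
        (hGint n m hnm) κ).trans ((hGe n m hnm).trans (hN n hn).le)
    calc _ ≤ P.real ({ω | M ≤ |W n ω|} ∪ {ω | M ≤ |W m ω|} ∪ {ω | κ ≤ G n m ω}) :=
          measureReal_mono hsub
      _ ≤ P.real {ω | M ≤ |W n ω|} + P.real {ω | M ≤ |W m ω|} + P.real {ω | κ ≤ G n m ω} :=
          (measureReal_union_le _ _).trans (by gcongr; exact measureReal_union_le _ _)
      _ ≤ δ := by linarith [hmark n, hmark m]
  intro ε hε
  rw [ENNReal.tendsto_nhds_zero]
  intro η hη
  rcases eq_or_ne η ⊤ with rfl | hη'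
  · simp
  obtain ⟨N, hN⟩ := hreal ε hε η.toReal (ENNReal.toReal_pos hη.ne' hη')
  rw [eventually_atTop_prod_self]
  refine ⟨N, fun n m hn hm => ?_⟩
  rcases le_total n m with h | h
  · exact (ENNReal.toReal_le_toReal (measure_ne_top _ _) hη').1 (hN n m hn h)
  · simp only [abs_sub_comm (W n _)]
    exact (ENNReal.toReal_le_toReal (measure_ne_top _ _) hη').1 (hN m n hm h)

/-- If functions `Y k` carry essentially the same mass above the level `k` as above a fixed level,
then along a subsequence this mass is located, up to a small error, on small sets on which
all later functions have a common sign pattern. -/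
lemma exists_sign_lower_bound {μ : Measure Ω} [IsFiniteMeasure μ] {Y : ℕ → Ω → ℝ} {C s c : ℝ}
    (hmeas : ∀ k, Measurable (Y k)) (hint : ∀ k, Integrable (Y k) μ)
    (hC : ∀ k, ∫ ω, |Y k ω| ∂μ ≤ C) (hs : 0 < s) (hc : 0 ≤ c)
    (hlow : ∀ k : ℕ, 15 / 16 * s ≤ ∫ ω in {ω | c + 2 ^ k < |Y k ω|}, |Y k ω| ∂μ)
    (hupp : ∀ k : ℕ, ∫ ω in {ω | c < |Y k ω|}, |Y k ω| ∂μ ≤ 17 / 16 * s) :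
    ∃ (σ : ℕ → ℕ) (T : ℕ → Set Ω) (g : Ω → ℝ),
      Tendsto (fun n => μ (T n)) atTop (nhds 0) ∧ Measurable g ∧ (∀ ω, |g ω| ≤ 1) ∧
      ∀ᶠ n in atTop, ∀ m, n < m → s / 2 ≤ ∫ ω in T n, g ω * Y (σ m) ω ∂μ := by
  set E : ℕ → Set Ω := fun k => {ω | c + 2 ^ k < |Y k ω|}
  have hE : ∀ k, MeasurableSet (E k) := fun k =>
    measurableSet_lt measurable_const (continuous_abs.measurable.comp (hmeas k))
  have hμE : ∀ k, μ (E k) ≤ ENNReal.ofReal C * 2⁻¹ ^ k := by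
    intro k
    have h1 : (2 : ℝ) ^ k * μ.real (E k) ≤ C := by
      refine le_trans ?_ ((mul_meas_ge_le_integral_of_nonneg
        (Eventually.of_forall fun ω => abs_nonneg (Y k ω)) (hint k).abs (2 ^ k)).trans (hC k))
      refine mul_le_mul_of_nonneg_left (measureReal_mono fun ω hω => ?_) (by positivity)
      change c + 2 ^ k < |Y k ω| at hω
      change 2 ^ k ≤ |Y k ω|
      linarith
    have h2 : μ.real (E k) ≤ C * 2⁻¹ ^ k := by
      rw [inv_pow, ← div_eq_mul_inv, le_div_iff₀ (by positivity)]; linarith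
    have h3 : ENNReal.ofReal (C * 2⁻¹ ^ k) = ENNReal.ofReal C * 2⁻¹ ^ k := by
      rw [ENNReal.ofReal_mul' (by positivity), ENNReal.ofReal_pow (by positivity),
        ENNReal.ofReal_inv_of_pos (by norm_num)]
      simp
    rw [← h3, ← ofReal_measureReal]
    exact ENNReal.ofReal_le_ofReal h2
  have hsum : ∑' k, ENNReal.ofReal C * 2⁻¹ ^ k ≠ ⊤ := by
    rw [ENNReal.tsum_mul_left]
    refine ENNReal.mul_ne_top ENNReal.ofReal_ne_top ?_
    rw [ENNReal.tsum_geometric]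
    simp
  set U : ℕ → Set Ω := fun k => ⋃ j, E (j + k)
  have hU0 : Tendsto (fun k => μ (U k)) atTop (nhds 0) :=
    tendsto_of_tendsto_of_tendsto_of_le_of_le tendsto_const_nhds
      (ENNReal.tendsto_sum_nat_add _ hsum) (fun _ => zero_le) fun k =>
      (measure_iUnion_le _).trans (ENNReal.tsum_le_tsum fun j => hμE (j + k))
  have hUmem : ∀ k l, k ≤ l → E l ⊆ U k := fun k l hkl =>
    (by rw [Nat.sub_add_cancel hkl] : E l = E (l - k + k)) ▸ subset_iUnion (fun j => E (j + k)) _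
  have hIU : ∀ k, Tendsto (fun l => ∫ ω in U l, |Y k ω| ∂μ) atTop (nhds 0) := fun k =>
    (hint k).abs.tendsto_setIntegral_nhds_zero hU0
  obtain ⟨σ, -, hσ⟩ := exists_seq_of_forall_finset_exists (fun _ : ℕ => True)
    (fun k l => k < l ∧ ∫ ω in U l, |Y k ω| ∂μ ≤ s / 8) (by
      intro t _
      have h : ∀ᶠ l in atTop, ∀ k ∈ t, k < l ∧ ∫ ω in U l, |Y k ω| ∂μ ≤ s / 8 := by
        rw [eventually_all_finset]
        intro k _
        filter_upwards [eventually_gt_atTop k,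
          (hIU k).eventually_lt_const (show 0 < s / 8 by positivity)] with l h1 h2
        exact ⟨h1, h2.le⟩
      obtain ⟨l, hl⟩ := h.exists
      exact ⟨l, trivial, hl⟩)
  have hσmono : StrictMono σ := fun m n hmn => (hσ m n hmn).1
  set T : ℕ → Set Ω := fun n => ⋃ j, ⋃ (_ : n < j), E (σ j)
  have hT : ∀ n, MeasurableSet (T n) := fun n =>
    MeasurableSet.iUnion fun j => MeasurableSet.iUnion fun _ => hE _
  have hTU : ∀ n, T n ⊆ U (σ (n + 1)) := fun n =>
    iUnion₂_subset fun j hj => hUmem _ _ (hσmono.monotone hj)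
  have hT0 : Tendsto (fun n => μ (T n)) atTop (nhds 0) :=
    tendsto_of_tendsto_of_tendsto_of_le_of_le tendsto_const_nhds
      (hU0.comp (hσmono.tendsto_atTop.comp (tendsto_add_atTop_nat 1))) (fun _ => zero_le)
      fun n => measure_mono (hTU n)
  have hTY : ∀ n, ∫ ω in T n, |Y (σ n) ω| ∂μ ≤ s / 8 := fun n =>
    (setIntegral_mono_set (hint _).abs.integrableOn (Eventually.of_forall fun _ => abs_nonneg _)
      (hTU n).eventuallyLE).trans (hσ n (n + 1) n.lt_succ_self).2
  set S : ℕ → Set Ω := fun m => E (σ m) \ T m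
  set A : Set Ω := ⋃ m, S m ∩ {ω | 0 ≤ Y (σ m) ω}
  have hA : MeasurableSet A := MeasurableSet.iUnion fun m =>
    ((hE _).diff (hT m)).inter (measurableSet_le measurable_const (hmeas _))
  have hS : ∀ m n ω, ω ∈ S m → ω ∈ S n → m = n := by
    intro m n ω hm hn
    rcases lt_trichotomy m n with h | h | h
    · exact absurd (mem_iUnion₂.2 ⟨n, h, hn.1⟩) hm.2
    · exact h
    · exact absurd (mem_iUnion₂.2 ⟨m, h, hm.1⟩) hn.2
  classical
  set g : Ω → ℝ := fun ω => if ω ∈ A then 1 else -1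
  have hg : Measurable g := Measurable.ite hA measurable_const measurable_const
  have hg1 : ∀ ω, |g ω| = 1 := by
    intro ω
    simp only [g]
    split_ifs <;> simp
  have hgS : ∀ m ω, ω ∈ S m → g ω * Y (σ m) ω = |Y (σ m) ω| := by
    intro m ω hω
    by_cases h : 0 ≤ Y (σ m) ω
    · have hωA : ω ∈ A := mem_iUnion.2 ⟨m, hω, h⟩
      simp [g, hωA, abs_of_nonneg h]
    · have hωA : ω ∉ A := by
        intro hmem
        obtain ⟨n, hn, hn'⟩ := mem_iUnion.1 hmem
        rw [hS n m ω hn hω] at hn'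
        exact h hn'
      simp [g, hωA, abs_of_neg (not_le.1 h)]
  have hgY : ∀ k, Integrable (fun ω => g ω * Y k ω) μ := fun k =>
    (hint k).bdd_mul hg.aestronglyMeasurable (Eventually.of_forall fun ω => (hg1 ω).le)
  refine ⟨σ, T, g, hT0, hg, fun ω => (hg1 ω).le, ?_⟩
  have hTr : Tendsto (fun n => c * μ.real (T n)) atTop (nhds 0) := by
    have := ((ENNReal.tendsto_toReal ENNReal.zero_ne_top).comp hT0).const_mul c
    simpa [Measure.real] using this
  filter_upwards [hTr.eventually_lt_const (show 0 < s / 16 by positivity)] with n hn m hnm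
  set y := Y (σ m)
  set F : Set Ω := {ω | c < |y ω|}
  have hF : MeasurableSet F :=
    measurableSet_lt measurable_const (continuous_abs.measurable.comp (hmeas _))
  have hEF : E (σ m) ⊆ F := fun ω hω => by
    change c + 2 ^ σ m < |y ω| at hω
    have : (0 : ℝ) < 2 ^ σ m := by positivity
    change c < |y ω|
    linarith
  have hyi : Integrable (fun ω => |y ω|) μ := (hint _).abs
  have hpt : ∀ ω, 2 * (E (σ m)).indicator (fun ω => |y ω|) ω
      - 2 * (T m).indicator (fun ω => |y ω|) ω - c - F.indicator (fun ω => |y ω|) ω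
      ≤ g ω * y ω := by
    intro ω
    have hlb : -|y ω| ≤ g ω * y ω := by
      have := neg_abs_le (g ω * y ω)
      rwa [abs_mul, hg1, one_mul] at this
    have hy0 := abs_nonneg (y ω)
    by_cases hωE : ω ∈ E (σ m)
    · have hωF := hEF hωE
      by_cases hωT : ω ∈ T m
      · simp only [indicator_of_mem, hωE, hωF, hωT]
        linarith
      · simp only [indicator_of_mem, indicator_of_notMem, hωE, hωF, hωT, not_false_eq_true]
        rw [hgS m ω ⟨hωE, hωT⟩]
        linarith
    · have h1 : 0 ≤ (T m).indicator (fun ω => |y ω|) ω := indicator_nonneg (fun _ _ => hy0) _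
      rw [indicator_of_notMem hωE]
      by_cases hωF : ω ∈ F
      · rw [indicator_of_mem hωF]; linarith
      · rw [indicator_of_notMem hωF]
        have : |y ω| ≤ c := not_lt.1 hωF
        linarith
  have hi1 : IntegrableOn (fun ω => 2 * (E (σ m)).indicator (fun ω => |y ω|) ω) (T n) μ :=
    ((hyi.indicator (hE _)).const_mul 2).integrableOn
  have hi2 : IntegrableOn (fun ω => 2 * (T m).indicator (fun ω => |y ω|) ω) (T n) μ :=
    ((hyi.indicator (hT _)).const_mul 2).integrableOn
  have hi3 : IntegrableOn (fun _ => c) (T n) μ := (integrable_const c).integrableOn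
  have hi4 : IntegrableOn (F.indicator fun ω => |y ω|) (T n) μ :=
    (hyi.indicator hF).integrableOn
  have hET : E (σ m) ⊆ T n := subset_iUnion₂ (s := fun j (_ : n < j) => E (σ j)) m hnm
  have hi12 : IntegrableOn (fun ω => 2 * (E (σ m)).indicator (fun ω => |y ω|) ω
      - 2 * (T m).indicator (fun ω => |y ω|) ω) (T n) μ := hi1.sub hi2
  have hi123 : IntegrableOn (fun ω => 2 * (E (σ m)).indicator (fun ω => |y ω|) ω
      - 2 * (T m).indicator (fun ω => |y ω|) ω - c) (T n) μ := hi12.sub hi3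
  have hkey : ∫ ω in T n, (2 * (E (σ m)).indicator (fun ω => |y ω|) ω
      - 2 * (T m).indicator (fun ω => |y ω|) ω - c - F.indicator (fun ω => |y ω|) ω) ∂μ
      ≤ ∫ ω in T n, g ω * y ω ∂μ :=
    setIntegral_mono (hi123.sub hi4) (hgY (σ m)).integrableOn hpt
  have hcomp : ∫ ω in T n, (2 * (E (σ m)).indicator (fun ω => |y ω|) ω
      - 2 * (T m).indicator (fun ω => |y ω|) ω - c - F.indicator (fun ω => |y ω|) ω) ∂μ
      = 2 * ∫ ω in E (σ m), |y ω| ∂μ - 2 * ∫ ω in T n ∩ T m, |y ω| ∂μ - c * μ.real (T n)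
        - ∫ ω in T n ∩ F, |y ω| ∂μ := by
    rw [integral_sub hi123 hi4, integral_sub hi12 hi3,
      integral_sub hi1 hi2, integral_const_mul, integral_const_mul, setIntegral_indicator (hE _),
      setIntegral_indicator (hT _), setIntegral_indicator hF, setIntegral_const,
      inter_eq_self_of_subset_right hET, smul_eq_mul, mul_comm c]
  have hb1 : ∫ ω in T n ∩ T m, |y ω| ∂μ ≤ s / 8 :=
    (setIntegral_mono_set hyi.integrableOn (Eventually.of_forall fun _ => abs_nonneg _)
      inter_subset_right.eventuallyLE).trans (hTY m)
  have hb2 : ∫ ω in T n ∩ F, |y ω| ∂μ ≤ 17 / 16 * s :=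
    (setIntegral_mono_set hyi.integrableOn (Eventually.of_forall fun _ => abs_nonneg _)
      inter_subset_right.eventuallyLE).trans (hupp _)
  have hb3 := hlow (σ m)
  change 15 / 16 * s ≤ ∫ ω in E (σ m), |y ω| ∂μ at hb3
  rw [hcomp] at hkey
  linarith

/-- A bounded set in `L¹` that is not uniformly integrable contains a sequence whose mass on
small sets is bounded below, coherently in sign. -/
lemma exists_seq_of_not_uiset {μ : Measure Ω} [IsFiniteMeasure μ] {K : Set (Ω → ℝ)}
    (hK : BddL1 μ K) (hUI : ¬ UIset μ K) :
    ∃ (X : ℕ → Ω → ℝ) (T : ℕ → Set Ω) (g : Ω → ℝ) (α : ℝ), (∀ m, X m ∈ K) ∧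
      Tendsto (fun n => μ (T n)) atTop (nhds 0) ∧ Measurable g ∧
      (∀ ω, |g ω| ≤ 1) ∧ 0 < α ∧
      ∀ᶠ n in atTop, ∀ m, n < m → α ≤ ∫ ω in T n, g ω * X m ω ∂μ := by
  obtain ⟨hint, C, hC⟩ := hK
  set V : Set ℝ := {ε | ∀ c : ℝ, ∃ X ∈ K, ε ≤ ∫ ω in {ω | c < |X ω|}, |X ω| ∂μ}
  obtain ⟨ε, hε, hεV⟩ : ∃ ε : ℝ, 0 < ε ∧ ε ∈ V := by
    by_contra hcon
    push Not at hcon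
    refine hUI ⟨hint, fun ε hε => ?_⟩
    have := hcon ε hε
    simp only [V, mem_ofPred_eq, not_forall, not_exists, not_and, not_le] at this
    exact this
  have hVbdd : BddAbove V := by
    refine ⟨C, fun ε hε => ?_⟩
    obtain ⟨X, hX, h⟩ := hε 0
    exact h.trans ((setIntegral_le_integral (hint X hX).abs
      (Eventually.of_forall fun _ => abs_nonneg _)).trans (hC X hX))
  set s := sSup V
  have hs : 0 < s := hε.trans_le (le_csSup hVbdd hεV)
  have hlowV : ∀ c : ℝ, ∃ X ∈ K, 15 / 16 * s ≤ ∫ ω in {ω | c < |X ω|}, |X ω| ∂μ := by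
    intro c
    obtain ⟨ε', hε', hlt⟩ := exists_lt_of_lt_csSup ⟨ε, hεV⟩ (show 15 / 16 * s < s by linarith)
    obtain ⟨X, hX, h⟩ := hε' c
    exact ⟨X, hX, hlt.le.trans h⟩
  obtain ⟨c₀, hc₀⟩ : ∃ c₀ : ℝ, ∀ X ∈ K, ∫ ω in {ω | c₀ < |X ω|}, |X ω| ∂μ < 17 / 16 * s := by
    have : 17 / 16 * s ∉ V := fun h => by linarith [le_csSup hVbdd h]
    simpa only [V, mem_ofPred_eq, not_forall, not_exists, not_and, not_le] using this
  choose X hXK hX using fun k : ℕ => hlowV (|c₀| + 2 ^ k)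
  set Y : ℕ → Ω → ℝ := fun k => (hint _ (hXK k)).1.mk (X k)
  have hXY : ∀ k, X k =ᵐ[μ] Y k := fun k => (hint _ (hXK k)).1.ae_eq_mk
  have htail : ∀ k (c : ℝ), ∫ ω in {ω | c < |X k ω|}, |X k ω| ∂μ
      = ∫ ω in {ω | c < |Y k ω|}, |Y k ω| ∂μ := by
    intro k c
    have hset : ({ω | c < |X k ω|} : Set Ω) =ᵐ[μ] {ω | c < |Y k ω|} := by
      filter_upwards [hXY k] with ω hω
      apply propext
      change c < |X k ω| ↔ c < |Y k ω|
      rw [hω]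
    rw [setIntegral_congr_set hset]
    refine integral_congr_ae (ae_restrict_of_ae ?_)
    filter_upwards [hXY k] with ω hω
    rw [hω]
  obtain ⟨σ, T, g, hT0, hg, hg1, h⟩ := exists_sign_lower_bound (μ := μ) (Y := Y) (C := C)
    (s := s) (c := |c₀|) (fun k => (hint _ (hXK k)).1.measurable_mk)
    (fun k => (hint _ (hXK k)).congr (hXY k))
    (fun k => by
      refine (integral_congr_ae ?_).trans_le (hC _ (hXK k))
      filter_upwards [hXY k] with ω hω
      rw [hω])
    hs (abs_nonneg _) (fun k => htail k _ ▸ hX k)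
    (fun k => by
      rw [← htail]
      refine le_trans (setIntegral_mono_set (hint _ (hXK k)).abs.integrableOn
        (Eventually.of_forall fun _ => abs_nonneg _) (LE.le.eventuallyLE ?_))
        (hc₀ _ (hXK k)).le
      exact fun ω hω => lt_of_le_of_lt (le_abs_self c₀) hω)
  refine ⟨fun m => X (σ m), T, g, s / 2, fun m => hXK _, hT0, hg, hg1, half_pos hs, ?_⟩
  filter_upwards [h] with n hn m hnm
  refine (hn m hnm).trans_eq (integral_congr_ae (ae_restrict_of_ae ?_))
  filter_upwards [hXY (σ m)] with ω hω
  rw [hω]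

lemma uiset_restrict_of_tendsto {P : Measure Ω} [IsProbabilityMeasure P] {K : Set (Ω → ℝ)}
    (hKconv : Convex ℝ K) (hK : BddL1 P K) {B : Set Ω}
    (hB : ∀ Xs : ℕ → Ω → ℝ, (∀ n, Xs n ∈ K) → CauchyInProb P Xs →
      Tendsto (fun p : ℕ × ℕ =>
        ∫⁻ ω in B, ENNReal.ofReal |Xs p.1 ω - Xs p.2 ω| ∂P) atTop (nhds 0)) :
    UIset (P.restrict B) K := by
  by_contra hUI
  set μ := P.restrict B
  have hintμ : ∀ X ∈ K, Integrable X μ := fun X hX => (hK.1 X hX).restrict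
  have hKμ : BddL1 μ K := by
    obtain ⟨hint, C, hC⟩ := hK
    exact ⟨hintμ, C, fun X hX => (setIntegral_le_integral (hint X hX).abs
      (Eventually.of_forall fun _ => abs_nonneg _)).trans (hC X hX)⟩
  obtain ⟨X, T, g, α, hXK, hT0, hg, hg1, hα, hlow⟩ := exists_seq_of_not_uiset hKμ hUI
  set D : ℕ → Set (Ω → ℝ) := fun n => convexHull ℝ (X '' {m | n < m})
  have hDK : ∀ n, D n ⊆ K := fun n =>
    convexHull_min (image_subset_iff.2 fun m _ => hXK m) hKconv
  obtain ⟨W, hWD, hWC⟩ := exists_cauchyInProb_of_antitone_convex hK hDK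
    (fun n => convex_convexHull ℝ _)
    (fun i j hij => convexHull_mono (image_mono fun m (hm : j < m) => hij.trans_lt hm))
    (fun n => ⟨X (n + 1), subset_convexHull ℝ _ ⟨n + 1, n.lt_succ_self, rfl⟩⟩)
  have hWμ : ∀ n, Integrable (W n) μ := fun n => hintμ _ (hDK n (hWD n))
  have hgint : ∀ (Z : Ω → ℝ), Integrable Z μ → Integrable (fun ω => g ω * Z ω) μ := fun Z hZ =>
    hZ.bdd_mul hg.aestronglyMeasurable (Eventually.of_forall fun ω => hg1 ω)
  have hlowW : ∀ᶠ n in atTop, α ≤ ∫ ω in T n, g ω * W n ω ∂μ := by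
    filter_upwards [hlow] with n hn
    have hconv : Convex ℝ {Z : Ω → ℝ | Integrable Z μ ∧ α ≤ ∫ ω in T n, g ω * Z ω ∂μ} := by
      rintro Z ⟨hZ, hZα⟩ Z' ⟨hZ', hZα'⟩ a b ha hb hab
      refine ⟨(hZ.smul a).add (hZ'.smul b), ?_⟩
      have : ∫ ω in T n, g ω * (a • Z + b • Z') ω ∂μ
          = a * ∫ ω in T n, g ω * Z ω ∂μ + b * ∫ ω in T n, g ω * Z' ω ∂μ := by
        rw [← integral_const_mul, ← integral_const_mul, ← integral_add
          ((hgint Z hZ).restrict.const_mul a) ((hgint Z' hZ').restrict.const_mul b)]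
        congr 1
        ext ω
        simp only [Pi.add_apply, Pi.smul_apply, smul_eq_mul]
        ring
      rw [this]
      calc α = a * α + b * α := by rw [← add_mul, hab, one_mul]
        _ ≤ _ := by gcongr
    refine (convexHull_min ?_ hconv (hWD n)).2
    rintro _ ⟨m, hm, rfl⟩
    exact ⟨hintμ _ (hXK m), hn m hm⟩
  have hL1 := hB W (fun n => hDK n (hWD n)) hWC
  obtain ⟨N, hN⟩ := eventually_atTop_prod_self.1
    (hL1.eventually_lt_const (show 0 < ENNReal.ofReal (α / 2) from
      ENNReal.ofReal_pos.2 (half_pos hα)))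
  have hWT : Tendsto (fun n => ∫ ω in T n, |W N ω| ∂μ) atTop (nhds 0) :=
    (hWμ N).abs.tendsto_setIntegral_nhds_zero hT0
  obtain ⟨n, h1, h2, h3⟩ := (hlowW.and ((hWT.eventually_lt_const (half_pos hα)).and
    (eventually_ge_atTop N))).exists
  have hdi : Integrable (fun ω => |W n ω - W N ω|) μ := ((hWμ n).sub (hWμ N)).abs
  have hdiff : ∫ ω, |W n ω - W N ω| ∂μ < α / 2 := by
    have h := hN n N h3 le_rfl
    have h' : ENNReal.ofReal (∫ ω, |W n ω - W N ω| ∂μ) < ENNReal.ofReal (α / 2) := by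
      rw [ofReal_integral_eq_lintegral_ofReal hdi
        (Eventually.of_forall fun _ => abs_nonneg _)]
      exact h
    exact (ENNReal.ofReal_lt_ofReal_iff (half_pos hα)).1 h'
  have hle : ∫ ω in T n, g ω * W n ω ∂μ
      ≤ ∫ ω in T n, |W N ω| ∂μ + ∫ ω in T n, |W n ω - W N ω| ∂μ := by
    rw [← integral_add (hWμ N).abs.restrict hdi.restrict]
    refine integral_mono (hgint _ (hWμ n)).restrict
      ((hWμ N).abs.restrict.add hdi.restrict) fun ω => ?_
    calc g ω * W n ω ≤ |g ω| * |W n ω| := (le_abs_self _).trans (abs_mul _ _).le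
      _ ≤ 1 * |W n ω| := by gcongr; exact hg1 ω
      _ = |W N ω + (W n ω - W N ω)| := by rw [one_mul, add_sub_cancel]
      _ ≤ |W N ω| + |W n ω - W N ω| := abs_add_le _ _
  have hle2 : ∫ ω in T n, |W n ω - W N ω| ∂μ ≤ ∫ ω, |W n ω - W N ω| ∂μ :=
    setIntegral_le_integral hdi (Eventually.of_forall fun _ => abs_nonneg _)
  linarith

lemma exists_seq_uiset_restrict_cover {P : Measure Ω} [IsProbabilityMeasure P]
    {K : Set (Ω → ℝ)}
    (h : ∀ A : Set Ω, MeasurableSet A → 0 < P A →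
      ∃ B ⊆ A, MeasurableSet B ∧ 0 < P B ∧ TailSmall (P.restrict B) K) :
    ∃ B : ℕ → Set Ω, (∀ n, MeasurableSet (B n)) ∧ (∀ n, TailSmall (P.restrict (B n)) K) ∧
      P (⋃ n, B n)ᶜ = 0 := by
  set V : Set (Set Ω) := {B | MeasurableSet B ∧ TailSmall (P.restrict B) K}
  have hV : V.Nonempty := ⟨∅, MeasurableSet.empty, fun ε _ => ⟨0, fun X _ => by simp⟩⟩
  obtain ⟨u, -, hu, huV⟩ := exists_seq_tendsto_sSup (hV.image P) (OrderTop.bddAbove _)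
  choose B hBV hBu using huV
  have hBm : ∀ n, MeasurableSet (B n) := fun n => (hBV n).1
  refine ⟨B, hBm, fun n => (hBV n).2, ?_⟩
  by_contra hpos
  obtain ⟨D, hDsub, hDm, hDpos, hD⟩ := h _ (MeasurableSet.iUnion hBm).compl
    (pos_iff_ne_zero.2 hpos)
  have hle : ∀ n, P D + u n ≤ sSup (P '' V) := by
    intro n
    have hdisj : Disjoint D (B n) := disjoint_left.2 fun ω hω hωB =>
      hDsub hω (mem_iUnion.2 ⟨n, hωB⟩)
    rw [← hBu n, ← measure_union hdisj (hBm n)]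
    exact le_sSup ⟨_, ⟨hDm.union (hBm n),
      (hD.add (hBV n).2).antitone_measure (Measure.restrict_union_le _ _)⟩, rfl⟩
  have hlim := le_of_tendsto' (hu.const_add (P D)) hle
  have hfin : sSup (P '' V) ≠ ⊤ := by
    refine ne_top_of_le_ne_top ENNReal.one_ne_top (sSup_le ?_)
    rintro _ ⟨B, -, rfl⟩
    exact prob_le_one
  exact absurd hlim (not_le.2 (by
    rw [add_comm]; exact ENNReal.lt_add_right hfin hDpos.ne'))

lemma exists_equivProb_uiset {P : Measure Ω} [IsProbabilityMeasure P]
    {K : Set (Ω → ℝ)} (hK : BddL1 P K)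
    (h : ∀ A : Set Ω, MeasurableSet A → 0 < P A →
      ∃ B ⊆ A, MeasurableSet B ∧ 0 < P B ∧ TailSmall (P.restrict B) K) :
    ∃ Q : Measure Ω, EquivProb P Q ∧ UIset Q K := by
  obtain ⟨hint, C, hC⟩ := hK
  obtain ⟨B, hBm, hB, hBP⟩ := exists_seq_uiset_restrict_cover h
  set w : ℕ → ENNReal := fun n => 2⁻¹ ^ (n + 1)
  have hw : ∑' n, w n = 1 := by
    simp only [w]
    rw [ENNReal.tsum_geometric_add_one, ENNReal.one_sub_inv_two, inv_inv]
    exact ENNReal.inv_mul_cancel (by simp) (by simp)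
  have hwtop : ∀ n, w n ≠ ⊤ := fun n => by simp [w]
  have hw0 : ∀ n, w n ≠ 0 := fun n => by simp [w]
  set R : Measure Ω := Measure.sum fun n => w n • P.restrict (B n)
  have hRapply : ∀ S, MeasurableSet S → R S = ∑' n, w n * P (S ∩ B n) := by
    intro S hS
    simp [R, Measure.sum_apply _ hS, Measure.restrict_apply hS]
  have hRP : R ≤ P := Measure.le_iff.2 fun S hS => by
    rw [hRapply S hS]
    calc ∑' n, w n * P (S ∩ B n) ≤ ∑' n, w n * P S :=
          ENNReal.tsum_le_tsum fun n => mul_le_mul_right (measure_mono inter_subset_left) _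
      _ = P S := by rw [ENNReal.tsum_mul_right, hw, one_mul]
  have hPR : P ≪ R := by
    refine Measure.AbsolutelyContinuous.mk fun S hS hS0 => ?_
    rw [hRapply S hS, ENNReal.tsum_eq_zero] at hS0
    have hSn : ∀ n, P (S ∩ B n) = 0 := fun n => (mul_eq_zero.1 (hS0 n)).resolve_left (hw0 n)
    have hsub : S ⊆ (⋃ n, S ∩ B n) ∪ (⋃ n, B n)ᶜ := by
      rw [← inter_iUnion]
      intro ω hω
      by_cases hωB : ω ∈ ⋃ n, B n
      · exact Or.inl ⟨hω, hωB⟩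
      · exact Or.inr hωB
    exact measure_mono_null hsub (measure_union_null (measure_iUnion_null hSn) hBP)
  have hRfin : IsFiniteMeasure R := isFiniteMeasure_of_le P hRP
  have hRne : R univ ≠ 0 := fun h0 => by
    have := hPR h0
    simp at this
  have hRK : TailSmall R K := by
    refine tailSmall_sum (b := fun n => w n * ENNReal.ofReal C)
      (fun n => (hB n).smul (hwtop n)) ?_ fun X hX n => ?_
    · rw [ENNReal.tsum_mul_right, hw, one_mul]
      exact ENNReal.ofReal_ne_top
    · rw [lintegral_smul_measure, smul_eq_mul]
      refine mul_le_mul_right ((setLIntegral_le_lintegral _ _).trans ?_) _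
      rw [← ofReal_integral_norm_eq_lintegral_enorm (hint X hX)]
      exact ENNReal.ofReal_le_ofReal (hC X hX)
  have hinv : (R univ)⁻¹ ≠ ⊤ := ENNReal.inv_ne_top.2 hRne
  refine ⟨(R univ)⁻¹ • R, ⟨⟨?_⟩, ?_, ?_⟩, ?_⟩
  · rw [Measure.smul_apply, smul_eq_mul]
    exact ENNReal.inv_mul_cancel hRne (measure_ne_top _ _)
  · exact (Measure.smul_absolutelyContinuous).trans (Measure.absolutelyContinuous_of_le hRP)
  · exact hPR.trans (Measure.absolutelyContinuous_smul
      (ENNReal.inv_ne_zero.2 (measure_ne_top _ _)))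
  · exact (uiset_iff_tailSmall _ _ fun X hX =>
      ((hint X hX).mono_measure hRP).smul_measure hinv).2 (hRK.smul hinv)

/-- Proposition 2.2: characterizations of existence of an equivalent measure making `K`
uniformly integrable. -/
theorem statement1 (P : Measure Ω) [IsProbabilityMeasure P]
    (K : Set (Ω → ℝ)) (hKconv : Convex ℝ K) (hKbdd : BddL1 P K) :
    List.TFAE
      [(∃ Q : Measure Ω, EquivProb P Q ∧ UIset Q K),
       (∀ ε : ℝ, 0 < ε → ∃ A : Set Ω, MeasurableSet A ∧ 1 - ε < (P A).toReal ∧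
          ∀ Xs : ℕ → Ω → ℝ, (∀ n, Xs n ∈ K) → CauchyInProb P Xs →
            Tendsto (fun p : ℕ × ℕ =>
              ∫⁻ ω in A, ENNReal.ofReal |Xs p.1 ω - Xs p.2 ω| ∂P) atTop (nhds 0)),
       (∀ A : Set Ω, MeasurableSet A → 0 < P A →
          ∃ B ⊆ A, MeasurableSet B ∧ 0 < P B ∧
          ∀ Xs : ℕ → Ω → ℝ, (∀ n, Xs n ∈ K) → CauchyInProb P Xs →
            Tendsto (fun p : ℕ × ℕ =>
              ∫⁻ ω in B, ENNReal.ofReal |Xs p.1 ω - Xs p.2 ω| ∂P) atTop (nhds 0)),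
       (∀ A : Set Ω, MeasurableSet A → 0 < P A →
          ∃ B ⊆ A, MeasurableSet B ∧ 0 < P B ∧
            UIset P ((fun X => B.indicator X) '' K))] := by
  tfae_have 1 → 2 := by
    rintro ⟨Q, ⟨hQ, -, hPQ⟩, hUI⟩ ε hε
    obtain ⟨A, hA, hPA, k, hk⟩ := exists_restrict_le_smul hPQ hε
    have hT : TailSmall (P.restrict A) K :=
      (((uiset_iff_tailSmall Q K hUI.1).1 hUI).smul (ENNReal.natCast_ne_top k)).antitone_measure hk
    exact ⟨A, hA, hPA, fun Xs hXs hC =>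
      tendsto_lintegral_of_cauchyInProb Measure.restrict_le_self hKbdd.1 hT hXs hC⟩
  tfae_have 2 → 3 := by
    intro h A hA hPA
    have hpos : 0 < P.real A := ENNReal.toReal_pos hPA.ne' (measure_ne_top _ _)
    obtain ⟨A', hA', hPA', hC⟩ := h (P.real A) hpos
    refine ⟨A ∩ A', inter_subset_left, hA.inter hA', ?_, fun Xs hXs hXC => ?_⟩
    · rw [pos_iff_ne_zero]
      intro h0
      have h1 : P.real (A ∪ A') + P.real (A ∩ A') = P.real A + P.real A' :=
        measureReal_union_add_inter hA'
      have h2 : P.real (A ∩ A') = 0 := by simp [Measure.real, h0]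
      have h3 : P.real (A ∪ A') ≤ 1 := measureReal_le_one
      change 1 - P.real A < P.real A' at hPA'
      linarith
    · exact tendsto_of_tendsto_of_tendsto_of_le_of_le tendsto_const_nhds (hC Xs hXs hXC)
        (fun _ => zero_le) fun _ => lintegral_mono_set inter_subset_right
  tfae_have 3 → 4 := by
    intro h A hA hPA
    obtain ⟨B, hBA, hB, hPB, hC⟩ := h A hA hPA
    exact ⟨B, hBA, hB, hPB,
      (uiset_indicator_iff P K hB).2 (uiset_restrict_of_tendsto hKconv hKbdd hC)⟩
  tfae_have 4 → 1 := by
    intro h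
    refine exists_equivProb_uiset hKbdd fun A hA hPA => ?_
    obtain ⟨B, hBA, hB, hPB, hUI⟩ := h A hA hPA
    rw [uiset_indicator_iff P K hB] at hUI
    exact ⟨B, hBA, hB, hPB, (uiset_iff_tailSmall _ K hUI.1).1 hUI⟩
  tfae_finish

end Paper
end
end

section
/- Let (Ω,Σ,P) be a probability space and let K be a convex set of random variables that is bounded in L^1(P). Let K̄ denote the closure of K in the topology of convergence in P-probability. The following are equivalent: (1) there exists a probability measure Q equivalent to P such that K is Q-uniformly integrable; (2) there exists a probability measure Q equivalent to P such that K̄ is Q-uniformly integrable; (3) there exists a probability measure Q equivalent to P such that the L^0(Q)- and L^1(Q)-topologies agree on K̄, i.e., for every sequence (X_n) in K̄ and every X ∈ K̄, (X_n) converges to X in P-probability if and only if E_Q[|X_n − X|] → 0. -/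
open MeasureTheory Filter Set ProbabilityTheory

noncomputable section

namespace Paper

variable {Ω : Type*} [MeasurableSpace Ω]

/-- Quantitative midpoint convexity of `x ↦ √(1 + x ^ 2)`. -/
lemma sq_sub_le_mul_sqrt_gap (a b : ℝ) :
    (a - b) ^ 2 ≤ 4 * (√(1 + a ^ 2) * √(1 + b ^ 2) * (√(1 + a ^ 2) + √(1 + b ^ 2))) *
      ((√(1 + a ^ 2) + √(1 + b ^ 2)) / 2 - √(1 + ((a + b) / 2) ^ 2)) ∧
    0 ≤ (√(1 + a ^ 2) + √(1 + b ^ 2)) / 2 - √(1 + ((a + b) / 2) ^ 2) := by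
  have hS : √(1 + a ^ 2) ^ 2 = 1 + a ^ 2 := Real.sq_sqrt (by positivity)
  have hT : √(1 + b ^ 2) ^ 2 = 1 + b ^ 2 := Real.sq_sqrt (by positivity)
  have hU : √(1 + ((a + b) / 2) ^ 2) ^ 2 = 1 + ((a + b) / 2) ^ 2 := Real.sq_sqrt (by positivity)
  have hS0 := Real.sqrt_nonneg (1 + a ^ 2)
  have hT0 := Real.sqrt_nonneg (1 + b ^ 2)
  have hU0 := Real.sqrt_nonneg (1 + ((a + b) / 2) ^ 2)
  set S := √(1 + a ^ 2)
  set T := √(1 + b ^ 2)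
  set U := √(1 + ((a + b) / 2) ^ 2)
  have hST : (S * T) ^ 2 - (1 + a * b) ^ 2 = (a - b) ^ 2 := by
    rw [mul_pow, hS, hT]; ring
  have habs : |1 + a * b| ≤ S * T :=
    abs_le_of_sq_le_sq (by nlinarith [sq_nonneg (a - b)]) (by positivity)
  obtain ⟨h1, h2⟩ := abs_le.1 habs
  have hdiff : (S + T) ^ 2 - (2 * U) ^ 2 = 2 * (S * T - (1 + a * b)) := by
    rw [mul_pow, hU, add_sq, hS, hT]; ring
  have hgap : 2 * U ≤ S + T := abs_le_of_sq_le_sq' (by linarith) (by positivity) |>.2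
  refine ⟨?_, by linarith⟩
  calc (a - b) ^ 2 = (S * T - (1 + a * b)) * (S * T + (1 + a * b)) := by rw [← hST]; ring
    _ ≤ (S * T - (1 + a * b)) * (2 * (S * T)) := by
        apply mul_le_mul_of_nonneg_left <;> linarith
    _ = (S + T - 2 * U) * (S + T + 2 * U) * (S * T) := by linear_combination (-(S * T)) * hdiff
    _ ≤ (S + T - 2 * U) * (2 * (S + T)) * (S * T) := by
        apply mul_le_mul_of_nonneg_right _ (by positivity)
        apply mul_le_mul_of_nonneg_left <;> linarith
    _ = _ := by ring

lemma sqrt_one_add_sq_le (a : ℝ) : √(1 + a ^ 2) ≤ 1 + |a| := by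
  rw [Real.sqrt_le_left (by positivity)]
  nlinarith [sq_abs a, abs_nonneg a]

lemma integrable_sqrt_one_add_sq {μ : Measure Ω} [IsFiniteMeasure μ] {f : Ω → ℝ}
    (hf : Integrable f μ) : Integrable (fun ω => √(1 + f ω ^ 2)) μ := by
  refine Integrable.mono' ((integrable_const (1 : ℝ)).add hf.abs) ?_ (ae_of_all _ fun ω => ?_)
  · exact (by fun_prop : Continuous fun x : ℝ => √(1 + x ^ 2)).comp_aestronglyMeasurable hf.1
  · rw [Real.norm_of_nonneg (Real.sqrt_nonneg _)]
    exact sqrt_one_add_sq_le _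

/-- The pointwise bound behind the `L¹`-Cauchy estimate. -/
lemma abs_sub_le_gap {ε c : ℝ} (hε : 0 < ε) (hc : 0 ≤ c) (a b : ℝ) :
    |a - b| ≤ ε + 8 * (1 + c) ^ 3 / ε *
      ((√(1 + a ^ 2) + √(1 + b ^ 2)) / 2 - √(1 + ((a + b) / 2) ^ 2)) +
      (if c < |a| ∨ c < |b| then |a| + |b| else 0) := by
  obtain ⟨h1, h2⟩ := sq_sub_le_mul_sqrt_gap a b
  set D := (√(1 + a ^ 2) + √(1 + b ^ 2)) / 2 - √(1 + ((a + b) / 2) ^ 2)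
  split_ifs with h
  · have : 0 ≤ 8 * (1 + c) ^ 3 / ε * D := by positivity
    linarith [abs_sub a b]
  · push Not at h
    have hS : √(1 + a ^ 2) ≤ 1 + c := (sqrt_one_add_sq_le a).trans (by linarith [h.1])
    have hT : √(1 + b ^ 2) ≤ 1 + c := (sqrt_one_add_sq_le b).trans (by linarith [h.2])
    have hM : 4 * (√(1 + a ^ 2) * √(1 + b ^ 2) * (√(1 + a ^ 2) + √(1 + b ^ 2))) ≤
        8 * (1 + c) ^ 3 := by
      calc _ ≤ 4 * ((1 + c) * (1 + c) * ((1 + c) + (1 + c))) := by gcongr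
        _ = _ := by ring
    have h3 : (a - b) ^ 2 ≤ 8 * (1 + c) ^ 3 * D := h1.trans (by gcongr)
    have h4 : |a - b| ≤ ε + (a - b) ^ 2 / ε := by
      have : |a - b| * ε ≤ ε * ε + (a - b) ^ 2 := by
        nlinarith [sq_abs (a - b), sq_nonneg (|a - b| - ε), abs_nonneg (a - b)]
      calc |a - b| = |a - b| * ε / ε := by field_simp
        _ ≤ (ε * ε + (a - b) ^ 2) / ε := by gcongr
        _ = _ := by field_simp
    have h5 : (a - b) ^ 2 / ε ≤ 8 * (1 + c) ^ 3 / ε * D := by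
      calc (a - b) ^ 2 / ε ≤ (8 * (1 + c) ^ 3 * D) / ε := by gcongr
        _ = _ := by ring
    linarith

/-- In a sequence of convex sets of functions, decreasing and uniformly integrable, one can pick
members converging in `L¹`. -/
theorem exists_seq_tendsto_L1 {μ : Measure Ω} [IsFiniteMeasure μ] {S : ℕ → Set (Ω → ℝ)}
    (hanti : Antitone S) (hne : ∀ k, (S k).Nonempty) (hconv : ∀ k, Convex ℝ (S k))
    (hmeas : ∀ f ∈ S 0, Measurable f) (hint : ∀ f ∈ S 0, Integrable f μ)
    {C : ℝ} (hC : ∀ f ∈ S 0, ∫ ω, |f ω| ∂μ ≤ C)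
    (hUI : ∀ ε : ℝ, 0 < ε → ∃ δ : ℝ, 0 < δ ∧ ∀ f ∈ S 0, ∀ A, MeasurableSet A →
      μ.real A ≤ δ → ∫ ω in A, |f ω| ∂μ ≤ ε) :
    ∃ (y : ℕ → Ω → ℝ) (u : Ω → ℝ), (∀ k, y k ∈ S k) ∧ Integrable u μ ∧
      Tendsto (fun k => ∫ ω, |y k ω - u ω| ∂μ) atTop (nhds 0) := by
  set Φ : (Ω → ℝ) → ℝ := fun f => ∫ ω, √(1 + f ω ^ 2) ∂μ with hΦ
  have h0 : ∀ k, S k ⊆ S 0 := fun k => hanti (Nat.zero_le k)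
  have hΦ0 : ∀ f, 0 ≤ Φ f := fun f => integral_nonneg fun ω => Real.sqrt_nonneg _
  have hΦC : ∀ f ∈ S 0, Φ f ≤ μ.real univ + C := fun f hf => by
    calc Φ f ≤ ∫ ω, (1 + |f ω|) ∂μ :=
          integral_mono (integrable_sqrt_one_add_sq (hint f hf))
            ((integrable_const (1 : ℝ)).add (hint f hf).abs) fun ω => sqrt_one_add_sq_le _
      _ = μ.real univ + ∫ ω, |f ω| ∂μ := by
          rw [integral_add (integrable_const _) (hint f hf).abs]; simp
      _ ≤ _ := by gcongr; exact hC f hf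
  set J : ℕ → ℝ := fun k => sInf (Φ '' S k) with hJ
  have hbdd : ∀ k, BddBelow (Φ '' S k) := fun k => ⟨0, by rintro _ ⟨f, -, rfl⟩; exact hΦ0 f⟩
  have hJle : ∀ k, ∀ f ∈ S k, J k ≤ Φ f := fun k f hf => csInf_le (hbdd k) ⟨f, hf, rfl⟩
  have hJmono : Monotone J := fun k l hkl =>
    csInf_le_csInf (hbdd k) ((hne l).image _) (image_mono (hanti hkl))
  have hJbdd : BddAbove (range J) := by
    refine ⟨μ.real univ + C, ?_⟩
    rintro _ ⟨k, rfl⟩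
    obtain ⟨f, hf⟩ := hne k
    exact (hJle k f hf).trans (hΦC f (h0 k hf))
  have hJlim := tendsto_atTop_ciSup hJmono hJbdd
  have hy : ∀ k : ℕ, ∃ f ∈ S k, Φ f < J k + 1 / ((k : ℝ) + 1) := fun k => by
    obtain ⟨_, ⟨f, hf, rfl⟩, h⟩ := exists_lt_of_csInf_lt ((hne k).image Φ)
      (lt_add_of_pos_right (J k) (by positivity : (0 : ℝ) < 1 / ((k : ℝ) + 1)))
    exact ⟨f, hf, h⟩
  choose y hyS hyΦ using hy
  have hy0 : ∀ k, y k ∈ S 0 := fun k => h0 k (hyS k)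
  have hyi : ∀ k, Integrable (y k) μ := fun k => hint _ (hy0 k)
  set G : ℕ → ℕ → Ω → ℝ := fun k l ω =>
    (√(1 + y k ω ^ 2) + √(1 + y l ω ^ 2)) / 2 - √(1 + ((y k ω + y l ω) / 2) ^ 2) with hG
  have hmid : ∀ k l, Integrable (fun ω => (y k ω + y l ω) / 2) μ := fun k l =>
    ((hyi k).add (hyi l)).div_const 2
  have hGi : ∀ k l, Integrable (G k l) μ := fun k l =>
    (((integrable_sqrt_one_add_sq (hyi k)).add (integrable_sqrt_one_add_sq (hyi l))).div_const
      2).sub (integrable_sqrt_one_add_sq (hmid k l))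
  have hGle : ∀ k l, k ≤ l → ∫ ω, G k l ω ∂μ ≤ (⨆ i, J i) - J k + 1 / ((k : ℝ) + 1) := by
    intro k l hkl
    have h1 : ∫ ω, G k l ω ∂μ = (Φ (y k) + Φ (y l)) / 2 - Φ (fun ω => (y k ω + y l ω) / 2) := by
      simp only [hG, hΦ]
      rw [integral_sub, integral_div, integral_add]
      · exact integrable_sqrt_one_add_sq (hyi k)
      · exact integrable_sqrt_one_add_sq (hyi l)
      · exact ((integrable_sqrt_one_add_sq (hyi k)).add
          (integrable_sqrt_one_add_sq (hyi l))).div_const 2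
      · exact integrable_sqrt_one_add_sq (hmid k l)
    have h2 : (fun ω => (y k ω + y l ω) / 2) ∈ S k := by
      have := (hconv k) (hyS k) (hanti hkl (hyS l)) (by norm_num : (0 : ℝ) ≤ 1 / 2)
        (by norm_num : (0 : ℝ) ≤ 1 / 2) (by norm_num)
      convert this using 1
      ext ω
      simp only [Pi.add_apply, Pi.smul_apply, smul_eq_mul]
      ring
    have h3 := hJle k _ h2
    have h4 := hyΦ k
    have h5 := hyΦ l
    have h6 := le_ciSup hJbdd l
    have h7 : 1 / ((l : ℝ) + 1) ≤ 1 / ((k : ℝ) + 1) := by gcongr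
    have h8 := le_ciSup hJbdd k
    rw [h1]
    linarith
  have hlim : Tendsto (fun k : ℕ => (⨆ i, J i) - J k + 1 / ((k : ℝ) + 1)) atTop (nhds 0) := by
    simpa using (hJlim.const_sub (⨆ i, J i)).add tendsto_one_div_add_atTop_nhds_zero_nat
  have hcauchy : ∀ ε : ℝ, 0 < ε → ∃ N, ∀ k ≥ N, ∀ l ≥ k, ∫ ω, |y k ω - y l ω| ∂μ ≤ ε := by
    intro ε hε
    obtain ⟨δ, hδ, hδ'⟩ := hUI (ε / 6) (by positivity)
    set m := μ.real univ with hm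
    have hm0 : 0 ≤ m := measureReal_nonneg
    obtain ⟨c, hc0, hc⟩ : ∃ c : ℝ, 0 < c ∧ 2 * C / c ≤ δ := by
      refine ⟨(2 * |C| + 1) / δ, by positivity, ?_⟩
      rw [div_le_iff₀ (by positivity), mul_div_cancel₀ _ hδ.ne']
      linarith [le_abs_self C]
    set ε' := ε / (6 * (m + 1)) with hε'
    have hε'0 : 0 < ε' := by positivity
    set M := 8 * (1 + c) ^ 3 / ε' with hM
    have hM0 : 0 < M := by positivity
    obtain ⟨N, hN⟩ := eventually_atTop.1 (hlim.eventually_lt_const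
      (by positivity : (0 : ℝ) < ε / (6 * M)))
    refine ⟨N, fun k hk l hl => ?_⟩
    set A := {ω | c < |y k ω| ∨ c < |y l ω|} with hA
    have hAm : MeasurableSet A :=
      (measurableSet_lt measurable_const (hmeas _ (hy0 k)).abs).union
        (measurableSet_lt measurable_const (hmeas _ (hy0 l)).abs)
    have hmark : ∀ j, μ.real {ω | c < |y j ω|} ≤ C / c := fun j => by
      rw [le_div_iff₀ hc0, mul_comm]
      refine le_trans ?_ ((mul_meas_ge_le_integral_of_nonneg (ae_of_all _ fun ω => abs_nonneg _)
        (hyi j).abs c).trans (hC _ (hy0 j)))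
      exact mul_le_mul_of_nonneg_left
        (measureReal_mono (fun ω (hω : c < |y j ω|) => hω.le) (measure_ne_top _ _)) hc0.le
    have hμA : μ.real A ≤ δ := by
      calc μ.real A ≤ μ.real {ω | c < |y k ω|} + μ.real {ω | c < |y l ω|} :=
            measureReal_union_le _ _
        _ ≤ C / c + C / c := add_le_add (hmark k) (hmark l)
        _ = 2 * C / c := by ring
        _ ≤ δ := hc
    have hind : Integrable (A.indicator fun ω => |y k ω| + |y l ω|) μ :=
      ((hyi k).abs.add (hyi l).abs).indicator hAm
    have hlin : Integrable (fun ω => ε' + M * G k l ω) μ :=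
      (integrable_const _).add ((hGi k l).const_mul M)
    have hGN : ∫ ω, G k l ω ∂μ ≤ ε / (6 * M) := (hGle k l hl).trans (hN k hk).le
    calc ∫ ω, |y k ω - y l ω| ∂μ
        ≤ ∫ ω, ((ε' + M * G k l ω) + A.indicator (fun ω => |y k ω| + |y l ω|) ω) ∂μ := by
          refine integral_mono ((hyi k).sub (hyi l)).abs
            (hlin.add hind) fun ω => ?_
          have := abs_sub_le_gap hε'0 hc0.le (y k ω) (y l ω)
          simpa only [indicator_apply, hA, mem_ofPred_eq, hM, hG] using this
      _ = m * ε' + M * ∫ ω, G k l ω ∂μ +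
            ((∫ ω in A, |y k ω| ∂μ) + ∫ ω in A, |y l ω| ∂μ) := by
          rw [integral_add hlin hind,
            integral_add (integrable_const _) ((hGi k l).const_mul M), integral_const_mul,
            integral_indicator hAm, integral_add (hyi k).abs.integrableOn (hyi l).abs.integrableOn]
          simp [hm]
      _ ≤ m * ε' + M * (ε / (6 * M)) + (ε / 6 + ε / 6) := by
          gcongr
          · exact hδ' _ (hy0 k) A hAm hμA
          · exact hδ' _ (hy0 l) A hAm hμA
      _ ≤ ε / 6 + ε / 6 + (ε / 6 + ε / 6) := by
          gcongr
          · rw [hε', mul_div_assoc', div_le_div_iff₀ (by positivity) (by positivity)]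
            nlinarith
          · apply le_of_eq; field_simp
      _ ≤ ε := by linarith
  have hdist : ∀ (f g : Ω → ℝ) (hf : Integrable f μ) (hg : Integrable g μ),
      dist (hf.toL1 f) (hg.toL1 g) = ∫ ω, |f ω - g ω| ∂μ := fun f g hf hg => by
    rw [dist_eq_norm, ← Integrable.toL1_sub, L1.norm_of_fun_eq_integral_norm]
    rfl
  have hcs : CauchySeq fun k => (hyi k).toL1 (y k) := by
    refine Metric.cauchySeq_iff'.2 fun ε hε => ?_
    obtain ⟨N, hN⟩ := hcauchy (ε / 2) (by positivity)
    refine ⟨N, fun n hn => ?_⟩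
    rw [dist_comm, hdist]
    linarith [hN N le_rfl n hn]
  obtain ⟨v, hv⟩ := cauchySeq_tendsto_of_complete hcs
  refine ⟨y, v, hyS, L1.integrable_coeFn v, ?_⟩
  have h := tendsto_iff_dist_tendsto_zero.1 hv
  refine h.congr fun k => ?_
  conv_lhs => rw [← Integrable.toL1_coeFn v (L1.integrable_coeFn v)]
  exact hdist _ _ _ _

lemma exists_extremal_seq {ι : Type*} {I : ι → ℕ → ℝ} {C : ℝ}
    (hC : ∀ i n, I i n ≤ C) {ε : ℝ} (hε : 0 < ε)
    (h : ∀ n, ∃ i, ε ≤ I i n) :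
    ∃ a : ℝ, 0 < a ∧ (∃ x : ℕ → ι, ∀ n : ℕ, a - 1 / ((n : ℝ) + 1) < I (x n) n) ∧
      ∀ η : ℝ, 0 < η → ∃ c, ∀ i, I i c ≤ a + η := by
  have : Nonempty ι := ⟨(h 0).choose⟩
  have hbdd : ∀ n, BddAbove (range fun i => I i n) := fun n => ⟨C, by
    rintro _ ⟨i, rfl⟩; exact hC i n⟩
  set s : ℕ → ℝ := fun n => ⨆ i, I i n with hs
  have hsε : ∀ n, ε ≤ s n := fun n => by
    obtain ⟨i, hi⟩ := h n
    exact hi.trans (le_ciSup (hbdd n) i)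
  have hsb : BddBelow (range s) := ⟨ε, by rintro _ ⟨n, rfl⟩; exact hsε n⟩
  refine ⟨⨅ n, s n, hε.trans_le (le_ciInf hsε), ?_, fun η hη => ?_⟩
  · have : ∀ n : ℕ, ∃ i, (⨅ n, s n) - 1 / ((n : ℝ) + 1) < I i n := fun n =>
      exists_lt_of_lt_ciSup (lt_of_lt_of_le (sub_lt_self _ (by positivity)) (ciInf_le hsb n))
    choose x hx using this
    exact ⟨x, hx⟩
  · obtain ⟨c, hc⟩ := exists_lt_of_ciInf_lt (lt_add_of_pos_right (⨅ n, s n) hη)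
    exact ⟨c, fun i => (le_ciSup (hbdd c) i).trans hc.le⟩

/-- Truncating an extremal sequence at increasing levels leaves a uniformly integrable sequence. -/
lemma truncation_unifIntegrable {μ : Measure Ω} [IsFiniteMeasure μ] {x : ℕ → Ω → ℝ}
    (hm : ∀ n, Measurable (x n)) (hi : ∀ n, Integrable (x n) μ) {a : ℝ}
    (hlow : ∀ n : ℕ, a - 1 / ((n : ℝ) + 1) < ∫ ω in {ω | (n : ℝ) < |x n ω|}, |x n ω| ∂μ)
    (hup : ∀ η : ℝ, 0 < η → ∃ c : ℕ, ∀ n,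
      ∫ ω in {ω | (c : ℝ) < |x n ω|}, |x n ω| ∂μ ≤ a + η)
    {ε : ℝ} (hε : 0 < ε) :
    ∃ δ : ℝ, 0 < δ ∧ ∀ n : ℕ, ∀ A, MeasurableSet A → μ.real A ≤ δ →
      ∫ ω in A, |{ω | (n : ℝ) < |x n ω|}ᶜ.indicator (x n) ω| ∂μ ≤ ε := by
  obtain ⟨c, hc⟩ := hup (ε / 4) (by positivity)
  obtain ⟨N, hN⟩ := exists_nat_one_div_lt (by positivity : 0 < ε / 4)
  set M := max c N
  have hlev : ∀ (k : ℕ) n, MeasurableSet {ω | (k : ℝ) < |x n ω|} := fun k n =>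
    measurableSet_lt measurable_const (hm n).abs
  refine ⟨ε / (2 * (M + 1)), by positivity, fun n A hA hμA => ?_⟩
  have hMA : (M : ℝ) * μ.real A ≤ ε / 2 := by
    calc (M : ℝ) * μ.real A ≤ M * (ε / (2 * (M + 1))) := by gcongr
      _ ≤ ε / 2 := by
        rw [mul_div_assoc', div_le_div_iff₀ (by positivity) (by positivity)]
        nlinarith
  have hui : Integrable ({ω | (n : ℝ) < |x n ω|}ᶜ.indicator (x n)) μ :=
    (hi n).indicator (hlev n n).compl
  rcases lt_or_ge n M with hn | hn
  · calc ∫ ω in A, |{ω | (n : ℝ) < |x n ω|}ᶜ.indicator (x n) ω| ∂μ ≤ ∫ ω in A, (M : ℝ) ∂μ := by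
          refine integral_mono hui.abs.integrableOn (integrable_const _) fun ω => ?_
          have hnM : (n : ℝ) ≤ M := by exact_mod_cast hn.le
          by_cases h : (n : ℝ) < |x n ω|
          · simp [h]
          · simp only [indicator, mem_compl_iff, mem_ofPred_eq, h, not_false_eq_true, if_true]
            linarith
      _ = M * μ.real A := by simp [mul_comm]
      _ ≤ ε := by linarith
  · have hcn : (c : ℝ) ≤ n := by exact_mod_cast (le_max_left c N).trans hn
    have hcM : (c : ℝ) ≤ M := by exact_mod_cast le_max_left c N
    set F := {ω | (c : ℝ) < |x n ω|}.indicator (fun ω => |x n ω|) with hF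
    set H := {ω | (n : ℝ) < |x n ω|}.indicator (fun ω => |x n ω|) with hH
    have hFi : Integrable F μ := (hi n).abs.indicator (hlev c n)
    have hHi : Integrable H μ := (hi n).abs.indicator (hlev n n)
    have hFHi : Integrable (fun ω => F ω - H ω) μ := hFi.sub hHi
    have hFH : ∀ ω, 0 ≤ F ω - H ω := fun ω => by
      simp only [hF, hH, indicator, mem_ofPred_eq]
      split_ifs <;> first | linarith [abs_nonneg (x n ω)]
    calc ∫ ω in A, |{ω | (n : ℝ) < |x n ω|}ᶜ.indicator (x n) ω| ∂μ
        ≤ ∫ ω in A, ((M : ℝ) + (F ω - H ω)) ∂μ := by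
          refine integral_mono hui.abs.integrableOn
            ((integrable_const _).add hFHi.integrableOn) fun ω => ?_
          simp only [hF, hH, indicator, mem_compl_iff, mem_ofPred_eq]
          split_ifs <;> simp <;> linarith
      _ = M * μ.real A + ∫ ω in A, (F ω - H ω) ∂μ := by
          rw [integral_add (integrable_const _) hFHi.integrableOn]
          simp [mul_comm]
      _ ≤ M * μ.real A + ∫ ω, (F ω - H ω) ∂μ := by
          gcongr
          · exact ae_of_all _ hFH
          · exact Measure.restrict_le_self
      _ = M * μ.real A + ((∫ ω in {ω | (c : ℝ) < |x n ω|}, |x n ω| ∂μ) -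
            ∫ ω in {ω | (n : ℝ) < |x n ω|}, |x n ω| ∂μ) := by
          rw [integral_sub hFi hHi, hF, hH, integral_indicator (hlev c n),
            integral_indicator (hlev n n)]
      _ ≤ ε := by
          have h1 := hc n
          have h2 := hlow n
          have h3 : 1 / ((n : ℝ) + 1) ≤ 1 / ((N : ℝ) + 1) := by
            gcongr
            exact (le_max_right c N).trans hn
          linarith

/-- A subsequence along which the sets `A` become negligible for all earlier functions. -/
lemma exists_subseq_small_tail {μ : Measure Ω} {x : ℕ → Ω → ℝ}
    (hi : ∀ n, Integrable (x n) μ) {A : ℕ → Set Ω}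
    (hA : Tendsto (fun n => μ (A n)) atTop (nhds 0)) (N : ℕ) {η : ℝ} (hη : 0 < η) :
    ∃ φ : ℕ → ℕ, (∀ j, N ≤ φ j) ∧ ∑' j, μ (A (φ j)) ≠ ⊤ ∧
      ∀ n, ∫ ω in ⋃ j, A (φ (n + 1 + j)), |x (φ n) ω| ∂μ ≤ η := by
  have key : ∀ j p : ℕ, ∃ q, p ≤ q ∧ μ (A q) ≤ 2⁻¹ ^ (j + 1) ∧
      ∀ i ∈ Finset.range (p + 1), ∫⁻ ω in A q, ‖x i ω‖ₑ ∂μ ≤ ENNReal.ofReal η * 2⁻¹ ^ (j + 1) := by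
    intro j p
    have hpos : (0 : ENNReal) < 2⁻¹ ^ (j + 1) := ENNReal.pow_pos (by simp) _
    have h1 := hA.eventually_le_const hpos
    have h2 : ∀ᶠ q in atTop, ∀ i ∈ Finset.range (p + 1),
        ∫⁻ ω in A q, ‖x i ω‖ₑ ∂μ ≤ ENNReal.ofReal η * 2⁻¹ ^ (j + 1) :=
      (eventually_all_finset _).2 fun i _ =>
        (tendsto_setLIntegral_zero (hi i).2.ne hA).eventually_le_const
          (ENNReal.mul_pos (by simpa using hη) hpos.ne')
    exact ((eventually_ge_atTop p).and (h1.and h2)).exists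
  choose q hqp hqμ hqx using key
  set φ : ℕ → ℕ := fun j => Nat.rec N (fun j p => q j p) j with hφ
  have hsucc : ∀ j, φ (j + 1) = q j (φ j) := fun j => rfl
  have hmono : Monotone φ := monotone_nat_of_le_succ fun j => by rw [hsucc]; exact hqp _ _
  refine ⟨fun j => φ (j + 1), fun j => (hmono (Nat.zero_le (j + 1)) : φ 0 ≤ φ (j + 1)), ?_, fun n => ?_⟩
  · refine ne_top_of_le_ne_top (b := 1) (by simp) ?_
    calc ∑' j, μ (A (φ (j + 1))) ≤ ∑' j : ℕ, (2⁻¹ : ENNReal) ^ (j + 1) :=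
          ENNReal.tsum_le_tsum fun j => by rw [hsucc]; exact hqμ _ _
      _ ≤ 1 := by
        simp only [ENNReal.tsum_geometric_add_one, ENNReal.one_sub_inv_two, inv_inv]
        exact (ENNReal.inv_mul_cancel (by simp) (by simp)).le
  · have hle : ∫⁻ ω in ⋃ j, A (φ (n + 1 + j + 1)), ‖x (φ (n + 1)) ω‖ₑ ∂μ ≤ ENNReal.ofReal η := by
      calc _ ≤ ∑' j, ∫⁻ ω in A (φ (n + 1 + j + 1)), ‖x (φ (n + 1)) ω‖ₑ ∂μ :=
            lintegral_iUnion_le _ _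
        _ ≤ ∑' j : ℕ, ENNReal.ofReal η * 2⁻¹ ^ (j + 1) := by
            refine ENNReal.tsum_le_tsum fun j => ?_
            rw [hsucc]
            refine (hqx (n + 1 + j) _ _ (Finset.mem_range_succ_iff.2 (hmono (show n + 1 ≤ n + 1 + j by omega)))).trans ?_
            gcongr ENNReal.ofReal η * ?_
            exact pow_le_pow_right_of_le_one' (by simp) (by omega)
        _ = ENNReal.ofReal η := by
            rw [ENNReal.tsum_mul_left, ENNReal.tsum_geometric_add_one, ENNReal.one_sub_inv_two,
              inv_inv, ENNReal.inv_mul_cancel (by simp) (by simp), mul_one]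
    rw [integral_eq_lintegral_of_nonneg_ae (ae_of_all _ fun ω => abs_nonneg _)
      (hi _).abs.integrableOn.1]
    refine ENNReal.toReal_le_of_le_ofReal hη.le ?_
    simpa only [← Real.enorm_eq_ofReal_abs] using hle

/-- A single bounded function that detects the mass of each `x n` on `A n`. -/
lemma exists_detecting_function {μ : Measure Ω} {x : ℕ → Ω → ℝ}
    (hm : ∀ n, Measurable (x n)) (hi : ∀ n, Integrable (x n) μ) {A : ℕ → Set Ω}
    (hA : ∀ n, MeasurableSet (A n)) {b η : ℝ}
    (hb : ∀ n, b ≤ ∫ ω in A n, |x n ω| ∂μ)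
    (hη : ∀ n, ∫ ω in ⋃ j, A (n + 1 + j), |x n ω| ∂μ ≤ η) :
    ∃ g : Ω → ℝ, Measurable g ∧ (∀ ω, |g ω| ≤ 1) ∧
      ∀ n, b - 2 * η ≤ ∫ ω, g ω * (A n).indicator (x n) ω ∂μ := by
  set E : ℕ → Set Ω := fun n => ⋃ j, A (n + 1 + j) with hE
  have hEm : ∀ n, MeasurableSet (E n) := fun n => MeasurableSet.iUnion fun j => hA _
  have hsub : ∀ m n, m < n → A n ⊆ E m := fun m n hmn => by
    obtain ⟨j, rfl⟩ := Nat.exists_eq_add_of_lt hmn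
    rw [show m + j + 1 = m + 1 + j by omega]
    exact subset_iUnion (fun j => A (m + 1 + j)) j
  obtain ⟨g, hg, hgx⟩ := exists_measurable_piecewise (fun n => A n \ E n)
    (fun n => (hA n).diff (hEm n)) (fun n ω => if 0 ≤ x n ω then (1 : ℝ) else -1)
    (fun n => Measurable.ite (measurableSet_le measurable_const (hm n)) measurable_const
      measurable_const) (by
      intro m n hmn ω hω
      rcases lt_or_gt_of_ne hmn with h | h
      · exact absurd (hsub m n h hω.2.1) hω.1.2
      · exact absurd (hsub n m h hω.1.1) hω.2.2)
  set g' : Ω → ℝ := fun ω => max (-1) (min 1 (g ω)) with hg'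
  have hg'm : Measurable g' := measurable_const.max (measurable_const.min hg)
  have hg'1 : ∀ ω, |g' ω| ≤ 1 := fun ω => abs_le.2 ⟨le_max_left _ _,
    max_le (by norm_num) (min_le_left _ _)⟩
  refine ⟨g', hg'm, hg'1, fun n => ?_⟩
  have hAi : Integrable ((A n).indicator fun ω => |x n ω|) μ := (hi n).abs.indicator (hA n)
  have hEi : Integrable ((E n).indicator fun ω => |x n ω|) μ := (hi n).abs.indicator (hEm n)
  calc b - 2 * η ≤ (∫ ω in A n, |x n ω| ∂μ) - 2 * ∫ ω in E n, |x n ω| ∂μ := by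
        linarith [hb n, hη n]
    _ = ∫ ω, ((A n).indicator (fun ω => |x n ω|) ω -
          2 * (E n).indicator (fun ω => |x n ω|) ω) ∂μ := by
        rw [integral_sub hAi (hEi.const_mul 2), integral_const_mul, integral_indicator (hA n),
          integral_indicator (hEm n)]
    _ ≤ _ := by
        refine integral_mono (hAi.sub (hEi.const_mul 2))
          (((hi n).indicator (hA n)).bdd_mul (c := 1) hg'm.aestronglyMeasurable
            (ae_of_all _ hg'1)) fun ω => ?_
        by_cases hωA : ω ∈ A n
        · by_cases hωE : ω ∈ E n
          · simp only [indicator_of_mem hωA, indicator_of_mem hωE]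
            have : |g' ω * x n ω| ≤ |x n ω| := by
              rw [abs_mul]; exact mul_le_of_le_one_left (abs_nonneg _) (hg'1 ω)
            linarith [neg_abs_le (g' ω * x n ω)]
          · simp only [indicator_of_mem hωA, indicator_of_notMem hωE]
            have h1 := hgx n ⟨hωA, hωE⟩
            simp only at h1
            simp only [hg', h1]
            split_ifs with h
            · simp [abs_of_nonneg h]
            · simp [abs_of_neg (not_le.1 h)]
        · simp only [indicator_of_notMem hωA, mul_zero]
          have : 0 ≤ (E n).indicator (fun ω => |x n ω|) ω :=
            indicator_nonneg (fun _ _ => abs_nonneg _) _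
          linarith

lemma eLpNorm_one_sub (μ : Measure Ω) (f g : Ω → ℝ) :
    eLpNorm (f - g) 1 μ = ∫⁻ ω, ENNReal.ofReal |f ω - g ω| ∂μ := by
  simp [eLpNorm_one_eq_lintegral_enorm, Real.enorm_eq_ofReal_abs]

/-- In the convex hull of the pairs `(u n, v n)`, `n ≥ k`, every convex condition holds that holds
for the generators. -/
lemma convexHull_pairs_subset {E : Type*} [AddCommGroup E] [Module ℝ E] {u v : ℕ → E} {k : ℕ}
    {D : Set (E × E)} (hD : Convex ℝ D) (h : ∀ n, k ≤ n → (u n, v n) ∈ D) :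
    convexHull ℝ ((fun n => (u n, v n)) '' {n | k ≤ n}) ⊆ D :=
  convexHull_min (by rintro _ ⟨n, hn, rfl⟩; exact h n hn) hD

lemma convex_setOf_integral_abs_le {ν : Measure Ω} (C : ℝ) :
    Convex ℝ {f : Ω → ℝ | Integrable f ν ∧ ∫ ω, |f ω| ∂ν ≤ C} := by
  rintro f ⟨hf, hfC⟩ g ⟨hg, hgC⟩ a b ha hb hab
  refine ⟨(hf.smul a).add (hg.smul b), ?_⟩
  calc ∫ ω, |(a • f + b • g) ω| ∂ν ≤ ∫ ω, (a * |f ω| + b * |g ω|) ∂ν := by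
        refine integral_mono ((hf.smul a).add (hg.smul b)).abs
          ((hf.abs.const_mul a).add (hg.abs.const_mul b)) fun ω => ?_
        simpa [abs_mul, abs_of_nonneg ha, abs_of_nonneg hb] using abs_add_le (a * f ω) (b * g ω)
    _ = a * (∫ ω, |f ω| ∂ν) + b * ∫ ω, |g ω| ∂ν := by
        rw [integral_add (hf.abs.const_mul a) (hg.abs.const_mul b), integral_const_mul,
          integral_const_mul]
    _ ≤ a * C + b * C := by gcongr
    _ = C := by rw [← add_mul, hab, one_mul]

lemma convex_setOf_measurable : Convex ℝ {f : Ω → ℝ | Measurable f} :=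
  fun _ hf _ hg a b _ _ _ => (Measurable.const_smul hf a).add (Measurable.const_smul hg b)

lemma convex_setOf_le_integral_mul {ν : Measure Ω} {g : Ω → ℝ} (hg : Measurable g)
    (hg1 : ∀ ω, |g ω| ≤ 1) (c : ℝ) :
    Convex ℝ {f : Ω → ℝ | Integrable f ν ∧ c ≤ ∫ ω, g ω * f ω ∂ν} := by
  rintro f ⟨hf, hfc⟩ h ⟨hh, hhc⟩ a b ha hb hab
  have hgi : ∀ {f : Ω → ℝ}, Integrable f ν → Integrable (fun ω => g ω * f ω) ν := fun hf =>
    hf.bdd_mul (c := 1) hg.aestronglyMeasurable (ae_of_all _ hg1)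
  refine ⟨(hf.smul a).add (hh.smul b), ?_⟩
  calc c = a * c + b * c := by rw [← add_mul, hab, one_mul]
    _ ≤ a * (∫ ω, g ω * f ω ∂ν) + b * ∫ ω, g ω * h ω ∂ν := by gcongr
    _ = ∫ ω, (a * (g ω * f ω) + b * (g ω * h ω)) ∂ν := by
        rw [integral_add ((hgi hf).const_mul a) ((hgi hh).const_mul b), integral_const_mul,
          integral_const_mul]
    _ = ∫ ω, g ω * (a • f + b • h) ω ∂ν := by
        congr 1; ext ω; simp; ring

/-- If, on a bounded convex set of integrable functions, convergence in measure forces convergence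
in `L¹`, then the set is uniformly integrable. -/
theorem uniform_tail_of_tendstoInMeasure {μ : Measure Ω} [IsFiniteMeasure μ] {K : Set (Ω → ℝ)}
    (hK : Convex ℝ K) (hm : ∀ X ∈ K, Measurable X) (hi : ∀ X ∈ K, Integrable X μ) {C : ℝ}
    (hC : ∀ X ∈ K, ∫ ω, |X ω| ∂μ ≤ C)
    (hagree : ∀ (w : ℕ → Ω → ℝ) (u : Ω → ℝ), (∀ n, w n ∈ K) → Integrable u μ →
      TendstoInMeasure μ w atTop u →
      Tendsto (fun n => ∫⁻ ω, ENNReal.ofReal |w n ω - u ω| ∂μ) atTop (nhds 0))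
    {ε : ℝ} (hε : 0 < ε) :
    ∃ c : ℝ, ∀ X ∈ K, ∫ ω in {ω | c < |X ω|}, |X ω| ∂μ < ε := by
  by_contra! hcon
  obtain ⟨a, ha, ⟨x, hx⟩, hup⟩ := exists_extremal_seq (ι := K)
    (I := fun X n => ∫ ω in {ω | (n : ℝ) < |X.1 ω|}, |X.1 ω| ∂μ) (C := C)
    (fun X n => (setIntegral_le_integral (hi _ X.2).abs (ae_of_all _ fun _ => abs_nonneg _)).trans
      (hC _ X.2)) hε (fun n => by
        obtain ⟨X, hX, h⟩ := hcon n
        exact ⟨⟨X, hX⟩, h⟩)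
  have hxm : ∀ n, Measurable (x n).1 := fun n => hm _ (x n).2
  have hxi : ∀ n, Integrable (x n).1 μ := fun n => hi _ (x n).2
  set A : ℕ → Set Ω := fun n => {ω | (n : ℝ) < |(x n).1 ω|} with hAdef
  have hAm : ∀ n, MeasurableSet (A n) := fun n => measurableSet_lt measurable_const (hxm n).abs
  have hAlim : Tendsto (fun n => μ (A n)) atTop (nhds 0) := by
    have hreal : Tendsto (fun n => μ.real (A n)) atTop (nhds 0) := by
      refine squeeze_zero' (Eventually.of_forall fun n => measureReal_nonneg)
        ((eventually_gt_atTop 0).mono fun n hn => ?_) (tendsto_const_div_atTop_nhds_zero_nat C)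
      rw [le_div_iff₀ (by exact_mod_cast hn), mul_comm]
      refine le_trans ?_ (hC _ (x n).2)
      refine le_trans ?_ (mul_meas_ge_le_integral_of_nonneg
        (ae_of_all _ fun _ => abs_nonneg _) (hxi n).abs n)
      gcongr
      · exact measure_ne_top _ _
      · exact ofPred_subset_ofPred.2 fun ω (hω : (n : ℝ) < _) => hω.le
    have := ENNReal.tendsto_ofReal hreal
    simpa using this
  obtain ⟨N, hN⟩ := exists_nat_one_div_lt (half_pos ha)
  obtain ⟨φ, hφN, hφsum, hφtail⟩ :=
    exists_subseq_small_tail hxi hAlim N (by positivity : 0 < a / 8)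
  obtain ⟨g, hgm, hg1, hg⟩ := exists_detecting_function (x := fun n => (x (φ n)).1)
    (A := fun n => A (φ n)) (b := a / 2) (fun n => hxm _) (fun n => hxi _) (fun n => hAm _)
    (fun n => by
      have h1 : 1 / ((φ n : ℝ) + 1) ≤ 1 / ((N : ℝ) + 1) := by
        gcongr
        exact hφN n
      have h2 := hx (φ n)
      simp only [hAdef]
      linarith) hφtail
  set u : ℕ → Ω → ℝ := fun n => (A (φ n))ᶜ.indicator (x (φ n)).1 with hu
  set v : ℕ → Ω → ℝ := fun n => (A (φ n)).indicator (x (φ n)).1 with hv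
  have hui : ∀ n, Integrable (u n) μ := fun n => (hxi _).indicator (hAm _).compl
  have hvi : ∀ n, Integrable (v n) μ := fun n => (hxi _).indicator (hAm _)
  set T : ℕ → Set ((Ω → ℝ) × (Ω → ℝ)) := fun k =>
    convexHull ℝ ((fun n => (u n, v n)) '' {n | k ≤ n}) with hT
  have hTanti : Antitone T := fun k l hkl =>
    convexHull_mono (image_mono fun n (hn : l ≤ n) => hkl.trans hn)
  have hTK : ∀ k, ∀ p ∈ T k, p.1 + p.2 ∈ K := fun k => convexHull_pairs_subset
    (hK.is_linear_preimage (IsLinearMap.isLinearMap_add)) fun n _ => by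
      change (A (φ n))ᶜ.indicator (x (φ n)).1 + (A (φ n)).indicator (x (φ n)).1 ∈ K
      rw [indicator_compl_add_self]
      exact (x (φ n)).2
  have hT1m : ∀ k, ∀ p ∈ T k, Measurable p.1 := fun k => convexHull_pairs_subset
    (convex_setOf_measurable.linear_preimage (LinearMap.fst ℝ _ _)) fun n _ =>
      (hxm _).indicator (hAm _).compl
  have hT1i : ∀ k, ∀ p ∈ T k, Integrable p.1 μ ∧ ∫ ω, |p.1 ω| ∂μ ≤ C := fun k =>
    convexHull_pairs_subset
      ((convex_setOf_integral_abs_le C).linear_preimage (LinearMap.fst ℝ _ _)) fun n _ => by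
        refine ⟨hui n, le_trans (integral_mono (hui n).abs (hxi _).abs fun ω => ?_)
          (hC _ (x (φ n)).2)⟩
        simp only [hu, indicator]
        split_ifs <;> simp
  have hT2 : ∀ k, ∀ p ∈ T k, Integrable p.2 μ ∧ a / 2 - 2 * (a / 8) ≤ ∫ ω, g ω * p.2 ω ∂μ :=
    fun k => convexHull_pairs_subset
      ((convex_setOf_le_integral_mul hgm hg1 _).linear_preimage (LinearMap.snd ℝ _ _))
        fun n _ => ⟨hvi n, hg n⟩
  have hT0 : ∀ k, ∀ ω, (∀ j, k ≤ j → ω ∉ A (φ j)) → ∀ p ∈ T k, p.2 ω = 0 := fun k ω hω =>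
    convexHull_pairs_subset (D := {p : (Ω → ℝ) × (Ω → ℝ) | p.2 ω = 0})
      ((convex_singleton (0 : ℝ)).linear_preimage
        ((LinearMap.proj ω : (Ω → ℝ) →ₗ[ℝ] ℝ) ∘ₗ LinearMap.snd ℝ _ _))
      fun n hn => indicator_of_notMem (hω n hn) _
  obtain ⟨y, y', hyT, hy'i, hylim⟩ := exists_seq_tendsto_L1 (μ := μ)
    (S := fun k => Prod.fst '' T k) (C := C)
    (fun k l hkl => image_mono (hTanti hkl))
    (fun k => ⟨u k, _, subset_convexHull _ _ ⟨k, le_refl k, rfl⟩, rfl⟩)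
    (fun k => (convex_convexHull ℝ _).linear_image (LinearMap.fst ℝ _ _))
    (by rintro _ ⟨p, hp, rfl⟩; exact hT1m 0 p hp)
    (by rintro _ ⟨p, hp, rfl⟩; exact (hT1i 0 p hp).1)
    (by rintro _ ⟨p, hp, rfl⟩; exact (hT1i 0 p hp).2)
    (by
      intro ε hε
      obtain ⟨δ, hδ, h⟩ := truncation_unifIntegrable hxm hxi hx
        (fun η hη => (hup η hη).imp fun c hc n => hc (x n)) hε
      refine ⟨δ, hδ, ?_⟩
      rintro _ ⟨p, hp, rfl⟩ B hB hμB
      exact (convexHull_pairs_subset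
        ((convex_setOf_integral_abs_le (ν := μ.restrict B) ε).linear_preimage
          (LinearMap.fst ℝ _ _)) (fun n _ => ⟨(hui n).integrableOn, h _ B hB hμB⟩) hp).2)
  choose p hpT hpy using hyT
  have hyi : ∀ k, Integrable (y k) μ := fun k => hpy k ▸ (hT1i k _ (hpT k)).1
  have hz0 : ∀ᵐ ω ∂μ, Tendsto (fun k => (p k).2 ω) atTop (nhds 0) := by
    filter_upwards [ae_eventually_notMem hφsum] with ω hω
    obtain ⟨k, hk⟩ := eventually_atTop.1 hω
    refine tendsto_const_nhds.congr' ((eventually_ge_atTop k).mono fun l hl => ?_)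
    exact (hT0 l ω (fun j hj => hk j (hl.trans hj)) _ (hpT l)).symm
  have hyM : TendstoInMeasure μ y atTop y' := by
    refine tendstoInMeasure_of_tendsto_eLpNorm one_ne_zero (fun k => (hyi k).1) hy'i.1 ?_
    have := ENNReal.tendsto_ofReal hylim
    rw [ENNReal.ofReal_zero] at this
    refine this.congr fun k => ?_
    rw [eLpNorm_one_sub]
    exact ofReal_integral_eq_lintegral_ofReal ((hyi k).sub hy'i).abs
      (ae_of_all _ fun _ => abs_nonneg _)
  obtain ⟨ns, hns, hyae⟩ := hyM.exists_seq_tendsto_ae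
  have hwM : TendstoInMeasure μ (fun k => y (ns k) + (p (ns k)).2) atTop y' := by
    refine tendstoInMeasure_of_tendsto_ae (fun k => ((hyi _).add (hT2 _ _ (hpT _)).1).1) ?_
    filter_upwards [hyae, hz0] with ω h1 h2
    simpa using h1.add (h2.comp hns.tendsto_atTop)
  have hw := hagree _ y' (fun k => by rw [← hpy]; exact hTK _ _ (hpT _)) hy'i hwM
  have hwR : Tendsto (fun k => ∫ ω, |(y (ns k) + (p (ns k)).2) ω - y' ω| ∂μ) atTop (nhds 0) := by
    have := (ENNReal.tendsto_toReal ENNReal.zero_ne_top).comp hw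
    refine this.congr fun k => ?_
    exact (integral_eq_lintegral_of_nonneg_ae (ae_of_all _ fun _ => abs_nonneg _)
      (((hyi _).add (hT2 _ _ (hpT _)).1).sub hy'i).abs.1).symm
  have hfin : ∀ k, a / 4 ≤ (∫ ω, |(y k + (p k).2) ω - y' ω| ∂μ) + ∫ ω, |y k ω - y' ω| ∂μ := by
    intro k
    have h2 := hT2 k _ (hpT k)
    have e1 : Integrable (fun ω => |(y k + (p k).2) ω - y' ω|) μ :=
      (((hyi k).add h2.1).sub hy'i).abs
    have e2 : Integrable (fun ω => |y k ω - y' ω|) μ := ((hyi k).sub hy'i).abs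
    calc a / 4 ≤ ∫ ω, g ω * (p k).2 ω ∂μ := by linarith [h2.2]
      _ ≤ ∫ ω, (|(y k + (p k).2) ω - y' ω| + |y k ω - y' ω|) ∂μ := by
        refine integral_mono (h2.1.bdd_mul (c := 1) hgm.aestronglyMeasurable (ae_of_all _ hg1))
          (e1.add e2) fun ω => ?_
        calc g ω * (p k).2 ω ≤ |g ω| * |(p k).2 ω| := by rw [← abs_mul]; exact le_abs_self _
          _ ≤ |(p k).2 ω| := mul_le_of_le_one_left (abs_nonneg _) (hg1 ω)
          _ = |((y k + (p k).2) ω - y' ω) - (y k ω - y' ω)| := by simp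
          _ ≤ _ := abs_sub _ _
      _ = _ := integral_add e1 e2
  have := ge_of_tendsto' (hwR.add (hylim.comp hns.tendsto_atTop)) fun k => hfin (ns k)
  linarith

lemma uniformIntegrable_comp {ι κ : Type*} {μ : Measure Ω} {f : ι → Ω → ℝ} {p : ENNReal}
    (h : UniformIntegrable f p μ) (σ : κ → ι) : UniformIntegrable (fun k => f (σ k)) p μ := by
  obtain ⟨hm, hu, C, hC⟩ := h
  refine ⟨fun k => hm _, fun ε hε => ?_, C, fun k => hC _⟩
  obtain ⟨δ, hδ, hδ'⟩ := hu hε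
  exact ⟨δ, hδ, fun k => hδ' _⟩

lemma tendstoInMeasure_of_absolutelyContinuous {μ ν : Measure Ω} [IsFiniteMeasure μ]
    [IsFiniteMeasure ν] (hνμ : ν ≪ μ) {f : ℕ → Ω → ℝ} {g : Ω → ℝ}
    (hf : ∀ n, AEStronglyMeasurable (f n) μ) (h : TendstoInMeasure μ f atTop g) :
    TendstoInMeasure ν f atTop g := by
  rw [exists_seq_tendstoInMeasure_atTop_iff fun n => (hf n).mono_ac hνμ]
  rw [exists_seq_tendstoInMeasure_atTop_iff hf] at h
  intro ns hns
  obtain ⟨ns', hns', h'⟩ := h ns hns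
  exact ⟨ns', hns', hνμ.ae_le h'⟩

lemma ofReal_setIntegral_abs {μ : Measure Ω} {X : Ω → ℝ} (hX : Integrable X μ) {s : Set Ω}
    (hs : NullMeasurableSet s μ) :
    ENNReal.ofReal (∫ ω in s, |X ω| ∂μ) = eLpNorm (s.indicator X) 1 μ := by
  rw [ofReal_integral_eq_lintegral_ofReal hX.abs.integrableOn (ae_of_all _ fun _ => abs_nonneg _),
    eLpNorm_one_eq_lintegral_enorm, ← lintegral_indicator₀ hs]
  refine lintegral_congr fun ω => ?_
  by_cases h : ω ∈ s <;> simp [h, Real.enorm_eq_ofReal_abs]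

lemma UIset_iff_uniformIntegrable {Q : Measure Ω} [IsFiniteMeasure Q] {K : Set (Ω → ℝ)} :
    UIset Q K ↔ UniformIntegrable (fun X : K => X.1) 1 Q := by
  have hlev : ∀ {X : Ω → ℝ}, Integrable X Q → ∀ c : ℝ, NullMeasurableSet {ω | c < |X ω|} Q :=
    fun hX c => nullMeasurableSet_lt aemeasurable_const hX.abs.aemeasurable
  constructor
  · rintro ⟨hi, h⟩
    refine uniformIntegrable_of le_rfl ENNReal.one_ne_top (fun X => (hi _ X.2).1) fun ε hε => ?_
    obtain ⟨c, hc⟩ := h ε hε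
    refine ⟨(c + 1).toNNReal, fun X => ?_⟩
    calc _ ≤ eLpNorm ({ω | c < |X.1 ω|}.indicator X.1) 1 Q := by
          refine eLpNorm_mono fun ω => norm_indicator_le_of_subset ?_ _ _
          intro ω hω
          have := Real.toNNReal_le_iff_le_coe.1 hω
          rw [coe_nnnorm, Real.norm_eq_abs] at this
          exact (lt_add_one c).trans_le this
      _ = _ := (ofReal_setIntegral_abs (hi _ X.2) (hlev (hi _ X.2) c)).symm
      _ ≤ ENNReal.ofReal ε := ENNReal.ofReal_le_ofReal (hc _ X.2).le
  · intro h
    have hi : ∀ X ∈ K, Integrable X Q := fun X hX => memLp_one_iff_integrable.1 (h.memLp ⟨X, hX⟩)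
    refine ⟨hi, fun ε hε => ?_⟩
    obtain ⟨C, hC⟩ := h.spec one_ne_zero ENNReal.one_ne_top (half_pos hε)
    refine ⟨C, fun X hX => lt_of_le_of_lt ?_ (half_lt_self hε)⟩
    rw [← ENNReal.ofReal_le_ofReal_iff (half_pos hε).le,
      ofReal_setIntegral_abs (hi X hX) (hlev (hi X hX) C)]
    refine le_trans (eLpNorm_mono fun ω => norm_indicator_le_of_subset ?_ _ _) (hC ⟨X, hX⟩)
    intro ω hω
    exact le_of_lt (show C < ‖X ω‖₊ from hω)

lemma UIset.probClosure {P Q : Measure Ω} [IsFiniteMeasure P] [IsFiniteMeasure Q] (hQP : Q ≪ P)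
    {K : Set (Ω → ℝ)} (hK : ∀ X ∈ K, AEStronglyMeasurable X P) (h : UIset Q K) :
    UIset Q (probClosure P K) := by
  rw [UIset_iff_uniformIntegrable] at h ⊢
  have h' := h.uniformIntegrable_of_tendstoInMeasure (atTop : Filter ℕ)
  have hmem : ∀ X ∈ Paper.probClosure P K, ∃ ni : ℕ → K,
      TendstoInMeasure Q ((fun X : K => X.1) ∘ ni) atTop X := by
    rintro X ⟨Xs, hXs, hlim⟩
    exact ⟨fun n => ⟨Xs n, hXs n⟩, tendstoInMeasure_of_absolutelyContinuous hQP
      (fun n => hK _ (hXs n)) hlim⟩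
  exact uniformIntegrable_comp h' fun X : Paper.probClosure P K => ⟨X.1, hmem _ X.2⟩

lemma UIset.topAgree {P Q : Measure Ω} [IsFiniteMeasure P] [IsFiniteMeasure Q] (hQP : Q ≪ P)
    (hPQ : P ≪ Q) {K : Set (Ω → ℝ)} (h : UIset Q K) : TopAgree P Q K := by
  have hK : ∀ X ∈ K, AEStronglyMeasurable X Q := fun X hX => (h.1 X hX).1
  have hUI := UIset_iff_uniformIntegrable.1 h
  intro Xs X hXs hX
  simp only [← eLpNorm_one_sub]
  constructor
  · intro hlim
    refine tendsto_Lp_finite_of_tendstoInMeasure le_rfl ENNReal.one_ne_top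
      (fun n => hK _ (hXs n)) (memLp_one_iff_integrable.2 (h.1 X hX))
      (uniformIntegrable_comp hUI fun n => (⟨Xs n, hXs n⟩ : K)).2.1
      (tendstoInMeasure_of_absolutelyContinuous hQP (fun n => (hK _ (hXs n)).mono_ac hPQ) hlim)
  · intro hlim
    exact tendstoInMeasure_of_absolutelyContinuous hPQ (fun n => hK _ (hXs n))
      (tendstoInMeasure_of_tendsto_eLpNorm one_ne_zero (fun n => hK _ (hXs n)) (hK _ hX) hlim)

/-- Two equivalent probability measures have a common equivalent probability measure dominated by
a multiple of each of them. -/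
lemma exists_equivProb_le_smul {P Q : Measure Ω} [IsProbabilityMeasure P] (hQ : EquivProb P Q) :
    ∃ (ν : Measure Ω) (κ : ENNReal), EquivProb P ν ∧ κ ≠ ⊤ ∧ ν ≤ κ • P ∧ ν ≤ κ • Q := by
  obtain ⟨hQp, hQP, hPQ⟩ := hQ
  set f : Ω → ENNReal := fun ω => min 1 (Q.rnDeriv P ω) with hf
  have hfm : Measurable f := measurable_const.min (Measure.measurable_rnDeriv Q P)
  set R₀ : Measure Ω := P.withDensity f with hR₀
  have hνP : R₀ ≤ P := by
    calc R₀ ≤ P.withDensity 1 := withDensity_mono (ae_of_all _ fun ω => min_le_left _ _)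
      _ = P := withDensity_one
  have hνQ : R₀ ≤ Q := by
    calc R₀ ≤ P.withDensity (Q.rnDeriv P) :=
          withDensity_mono (ae_of_all _ fun ω => min_le_right _ _)
      _ = Q := Measure.withDensity_rnDeriv_eq Q P hQP
  have hPν : P ≪ R₀ := by
    refine withDensity_absolutelyContinuous' hfm.aemeasurable ?_
    filter_upwards [Measure.rnDeriv_pos' hPQ] with ω hω
    exact (lt_min one_pos hω).ne'
  have h0 : R₀ univ ≠ 0 := fun h => by simpa using hPν h
  have htop : R₀ univ ≠ ⊤ := ne_top_of_le_ne_top (measure_ne_top P univ) (hνP univ)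
  have hfin : IsFiniteMeasure R₀ := ⟨htop.lt_top⟩
  have : NeZero R₀ := ⟨fun h => h0 (by simp [h])⟩
  refine ⟨(R₀ univ)⁻¹ • R₀, (R₀ univ)⁻¹, ⟨inferInstance, ?_, ?_⟩, ENNReal.inv_ne_top.2 h0, ?_, ?_⟩
  · exact (Measure.smul_absolutelyContinuous).trans hνP.absolutelyContinuous
  · exact hPν.trans (Measure.absolutelyContinuous_smul (ENNReal.inv_ne_zero.2 htop))
  · gcongr
  · gcongr

lemma exists_UIset_of_topAgree {P Q : Measure Ω} [IsProbabilityMeasure P] {K : Set (Ω → ℝ)}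
    (hK : Convex ℝ K) (hb : BddL1 P K) (hQ : EquivProb P Q)
    (hag : TopAgree P Q (probClosure P K)) : ∃ ν : Measure Ω, EquivProb P ν ∧ UIset ν K := by
  obtain ⟨ν, κ, hν, hκ, hνP, hνQ⟩ := exists_equivProb_le_smul hQ
  refine ⟨ν, hν, ?_⟩
  obtain ⟨hνp, hνac, hPν⟩ := hν
  obtain ⟨hi, C, hC⟩ := hb
  have hiν : ∀ {X : Ω → ℝ}, Integrable X P → Integrable X ν := fun hX =>
    (hX.smul_measure hκ).mono_measure hνP
  set K' : Set (Ω → ℝ) := {X | Measurable X ∧ ∃ Y ∈ K, X =ᵐ[P] Y} with hK'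
  have hK'i : ∀ X ∈ K', Integrable X P := fun X ⟨_, Y, hY, hXY⟩ => (hi Y hY).congr hXY.symm
  have hK'c : Convex ℝ K' := by
    rintro X ⟨hXm, X', hX', hXX'⟩ Y ⟨hYm, Y', hY', hYY'⟩ a b ha hb hab
    exact ⟨(hXm.const_smul a).add (hYm.const_smul b), _, hK hX' hY' ha hb hab,
      (hXX'.const_smul a).add (hYY'.const_smul b)⟩
  have hsub : K ⊆ probClosure P K := fun X hX => ⟨fun _ => X, fun _ => hX, by
    intro ε hε
    simp [hε.ne']⟩
  have hmain := fun (ε : ℝ) (hε : 0 < ε) => uniform_tail_of_tendstoInMeasure (μ := ν) hK'c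
    (fun X hX => hX.1) (fun X hX => hiν (hK'i X hX)) (C := κ.toReal * C) (by
      rintro X ⟨hXm, Y, hY, hXY⟩
      calc ∫ ω, |X ω| ∂ν ≤ ∫ ω, |X ω| ∂(κ • P) :=
            integral_mono_measure hνP (ae_of_all _ fun _ => abs_nonneg _)
              ((hK'i X ⟨hXm, Y, hY, hXY⟩).abs.smul_measure hκ)
        _ = κ.toReal * ∫ ω, |X ω| ∂P := by rw [integral_smul_measure, smul_eq_mul]
        _ = κ.toReal * ∫ ω, |Y ω| ∂P := by
            exact congrArg _ (integral_congr_ae (hXY.fun_comp abs))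
        _ ≤ κ.toReal * C := by gcongr; exact hC Y hY) (by
      intro w u hw _ hlim
      choose hwm Y hY hwY using hw
      have hlimP : TendstoInMeasure P Y atTop u :=
        (tendstoInMeasure_of_absolutelyContinuous hPν
          (fun n => (hwm n).aestronglyMeasurable) hlim).congr_left hwY
      have hu : u ∈ probClosure P K := ⟨Y, hY, hlimP⟩
      have hQlim := (hag Y u (fun n => hsub (hY n)) hu).1 hlimP
      have hκlim := ENNReal.Tendsto.const_mul hQlim (Or.inr hκ)
      rw [mul_zero] at hκlim
      refine tendsto_of_tendsto_of_tendsto_of_le_of_le tendsto_const_nhds hκlim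
        (fun _ => zero_le) fun n => ?_
      calc ∫⁻ ω, ENNReal.ofReal |w n ω - u ω| ∂ν
          = ∫⁻ ω, ENNReal.ofReal |Y n ω - u ω| ∂ν := by
            refine lintegral_congr_ae ?_
            filter_upwards [hνac.ae_le (hwY n)] with ω hω
            rw [hω]
        _ ≤ ∫⁻ ω, ENNReal.ofReal |Y n ω - u ω| ∂(κ • Q) := lintegral_mono' hνQ le_rfl
        _ = κ * ∫⁻ ω, ENNReal.ofReal |Y n ω - u ω| ∂Q := by
            rw [lintegral_smul_measure, smul_eq_mul]) hε
  refine ⟨fun X hX => hiν (hi X hX), fun ε hε => ?_⟩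
  obtain ⟨c, hc⟩ := hmain ε hε
  refine ⟨c, fun X hX => ?_⟩
  have hXm := (hi X hX).1.aemeasurable
  have hae : X =ᵐ[ν] hXm.mk X := hνac.ae_le hXm.ae_eq_mk
  have := hc (hXm.mk X) ⟨hXm.measurable_mk, X, hX, hXm.ae_eq_mk.symm⟩
  rwa [setIntegral_congr_set (t := {ω | c < |hXm.mk X ω|}), integral_congr_ae]
  · exact ae_restrict_of_ae (hae.fun_comp abs)
  · filter_upwards [hae] with ω hω
    change (c < |X ω|) = (c < |hXm.mk X ω|)
    rw [hω]

/-- Corollary 2.3: uniform integrability of `K`, of its closure in probability, and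
agreement of the `L⁰(Q)`- and `L¹(Q)`-topologies on the closure. -/
theorem statement2 (P : Measure Ω) [IsProbabilityMeasure P]
    (K : Set (Ω → ℝ)) (hKconv : Convex ℝ K) (hKbdd : BddL1 P K) :
    List.TFAE
      [(∃ Q : Measure Ω, EquivProb P Q ∧ UIset Q K),
       (∃ Q : Measure Ω, EquivProb P Q ∧ UIset Q (probClosure P K)),
       (∃ Q : Measure Ω, EquivProb P Q ∧ TopAgree P Q (probClosure P K))] := by
  tfae_have 1 → 2 := by
    rintro ⟨Q, hQ, h⟩
    have := hQ.1
    exact ⟨Q, hQ, h.probClosure hQ.2.1 fun X hX => (hKbdd.1 X hX).1⟩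
  tfae_have 2 → 3 := by
    rintro ⟨Q, hQ, h⟩
    have := hQ.1
    exact ⟨Q, hQ, h.topAgree hQ.2.1 hQ.2.2⟩
  tfae_have 3 → 1 := by
    rintro ⟨Q, hQ, h⟩
    exact exists_UIset_of_topAgree hKconv hKbdd hQ h
  tfae_finish

end Paper
end
end
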